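/- arXiv:2211.03291 — 4 statements merged into one kernel-verified Lean document; each statement's English description precedes it below -/
import Mathlib

section
/- Let k ≥ 2 and let G be a properly edge-colored graph containing no rainbow cycle of length 2k. Then |Hom(C_{2k}, G)| ≤ (2k)^{2k} · |Hom(S_k, G)|, where S_k is the star with k leaves. -/
namespace RainbowAux
open Matrix Finset

lemma young (k : ℕ) {x y : ℝ} (hx : 0 ≤ x) (hy : 0 ≤ y) :
    ((k : ℝ) + 1) * (x ^ k * y) ≤ k * x ^ (k + 1) + y ^ (k + 1) := by
  induction k with
  | zero => simp
  | succ k ih =>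
    have h1 := mul_le_mul_of_nonneg_left ih hy
    have h2 : 0 ≤ ((k : ℝ) + 1) * x ^ k * (x - y) ^ 2 := by positivity
    push_cast
    have e1 : x ^ (k + 1 + 1) = x ^ k * x * x := by ring
    have e2 : x ^ (k + 1) = x ^ k * x := by ring
    have e3 : y ^ (k + 1 + 1) = y * y ^ (k + 1) := by ring
    rw [e1, e2, e3]
    rw [e2] at h1
    nlinarith

lemma two_term (a b : ℕ) {x y : ℝ} (hx : 0 ≤ x) (hy : 0 ≤ y) :
    x ^ a * y ^ b + x ^ b * y ^ a ≤ x ^ (a + b) + y ^ (a + b) := by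
  have h : 0 ≤ (x ^ a - y ^ a) * (x ^ b - y ^ b) := by
    rcases le_total x y with h | h
    · exact mul_nonneg_of_nonpos_of_nonpos
        (sub_nonpos.2 (pow_le_pow_left₀ hx h a)) (sub_nonpos.2 (pow_le_pow_left₀ hx h b))
    · exact mul_nonneg
        (sub_nonneg.2 (pow_le_pow_left₀ hy h a)) (sub_nonneg.2 (pow_le_pow_left₀ hy h b))
  rw [pow_add, pow_add]
  nlinarith

lemma two_term_abs (a b : ℕ) (hab : Even (a + b)) (x y : ℝ) :
    x ^ a * y ^ b + x ^ b * y ^ a ≤ x ^ (a + b) + y ^ (a + b) := by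
  have h := two_term a b (abs_nonneg x) (abs_nonneg y)
  rw [hab.pow_abs, hab.pow_abs] at h
  refine le_trans (add_le_add ?_ ?_) h
  · rw [← abs_pow, ← abs_pow, ← abs_mul]; exact le_abs_self _
  · rw [← abs_pow, ← abs_pow, ← abs_mul]; exact le_abs_self _

variable {V : Type*} [Fintype V] [DecidableEq V]

lemma exists_spec (A : Matrix V V ℝ) (hA : Aᵀ = A) :
    ∃ (U : Matrix V V ℝ) (l : V → ℝ), ∀ m : ℕ, A ^ m = U * diagonal (fun p => l p ^ m) * Uᵀ := by
  have hH : A.IsHermitian := by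
    rw [Matrix.IsHermitian, conjTranspose_eq_transpose_of_trivial]; exact hA
  have h1 := hH.spectral_theorem
  rw [Unitary.conjStarAlgAut_apply] at h1
  set U : Matrix V V ℝ := (hH.eigenvectorUnitary : Matrix V V ℝ) with hU
  have hUs : star U = Uᵀ := by
    rw [star_eq_conjTranspose, conjTranspose_eq_transpose_of_trivial]
  have hs : U * Uᵀ = 1 := by
    rw [← hUs]; exact Unitary.mul_star_self_of_mem hH.eigenvectorUnitary.2
  have hs' : Uᵀ * U = 1 := by
    rw [← hUs]; exact Unitary.star_mul_self_of_mem hH.eigenvectorUnitary.2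
  refine ⟨U, hH.eigenvalues, fun m => ?_⟩
  induction m with
  | zero => simp [hs]
  | succ m ih =>
    have h2 : A = U * diagonal hH.eigenvalues * Uᵀ := by
      rw [← hUs]; simpa [Function.comp_def] using h1
    rw [pow_succ, ih]
    refine (congrArg (fun X => U * diagonal (fun p => hH.eigenvalues p ^ m) * Uᵀ * X) h2).trans ?_
    calc U * diagonal (fun p => hH.eigenvalues p ^ m) * Uᵀ * (U * diagonal hH.eigenvalues * Uᵀ)
        = U * diagonal (fun p => hH.eigenvalues p ^ m) * (Uᵀ * U) * (diagonal hH.eigenvalues * Uᵀ) := by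
          simp only [Matrix.mul_assoc]
      _ = _ := by
        rw [hs', Matrix.mul_one, ← Matrix.mul_assoc, Matrix.mul_assoc U, diagonal_mul_diagonal]
        simp only [pow_succ]

lemma trace_ineq (A M : Matrix V V ℝ) (hA : Aᵀ = A) (hM : Mᵀ = M) (a b : ℕ) (hab : Even (a + b)) :
    trace (M * A ^ a * M * A ^ b) ≤ trace (M * M * A ^ (a + b)) := by
  obtain ⟨U, l, h⟩ := exists_spec A hA
  have gen : ∀ a b : ℕ, trace (M * A ^ a * M * A ^ b) =
      ∑ p, ∑ q, (Uᵀ * M * U) p q ^ 2 * (l p ^ b * l q ^ a) := by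
    intro a b
    set W := Uᵀ * M * U with hW
    have hWs : ∀ p q, W p q = W q p := by
      intro p q
      have : Wᵀ = W := by simp [hW, hM, Matrix.mul_assoc]
      conv_lhs => rw [← this]
      rfl
    have e : trace (M * A ^ a * M * A ^ b) =
        trace (W * diagonal (fun p => l p ^ a) * (W * diagonal (fun p => l p ^ b))) := by
      rw [h a, h b, ← Matrix.mul_assoc (M * _ * M), trace_mul_comm]
      simp only [hW, Matrix.mul_assoc]
    rw [e, trace]
    refine Finset.sum_congr rfl fun p _ => ?_
    rw [diag_apply, Matrix.mul_apply]
    refine Finset.sum_congr rfl fun q _ => ?_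
    rw [mul_diagonal, mul_diagonal, hWs q p]
    ring
  have e0 : trace (M * M * A ^ (a + b)) = trace (M * A ^ 0 * M * A ^ (a + b)) := by simp
  have hsymm : ∀ p q, (Uᵀ * M * U) p q = (Uᵀ * M * U) q p := by
    intro p q
    have : (Uᵀ * M * U)ᵀ = Uᵀ * M * U := by simp [hM, Matrix.mul_assoc]
    conv_lhs => rw [← this]
    rfl
  rw [e0, gen, gen]
  have sw : ∀ a b : ℕ, 2 * ∑ p, ∑ q, (Uᵀ * M * U) p q ^ 2 * (l p ^ b * l q ^ a) =
      ∑ p, ∑ q, (Uᵀ * M * U) p q ^ 2 * (l p ^ b * l q ^ a + l p ^ a * l q ^ b) := by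
    intro a b
    rw [two_mul]
    conv_lhs => arg 2; rw [Finset.sum_comm]
    rw [← Finset.sum_add_distrib]
    refine Finset.sum_congr rfl fun p _ => ?_
    rw [← Finset.sum_add_distrib]
    refine Finset.sum_congr rfl fun q _ => ?_
    rw [hsymm q p]; ring
  refine le_of_mul_le_mul_left ?_ (two_pos : (0 : ℝ) < 2)
  rw [sw, sw]
  refine Finset.sum_le_sum fun p _ => Finset.sum_le_sum fun q _ => ?_
  refine mul_le_mul_of_nonneg_left ?_ (sq_nonneg _)
  have := two_term_abs b a (by rwa [add_comm]) (l p) (l q)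
  rw [add_comm b a] at this
  simpa using this

lemma moment_ineq (A : Matrix V V ℝ) (hA : Aᵀ = A) (d : V → ℝ) (hd : ∀ v, 0 ≤ d v) (k : ℕ) :
    ((k : ℝ) + 1) * ∑ v, d v * (A ^ (2 * k)) v v ≤
      k * trace (A ^ (2 * (k + 1))) + ∑ v, d v ^ (k + 1) := by
  obtain ⟨U, l, h⟩ := exists_spec A hA
  have hv : ∀ m v, (A ^ m) v v = ∑ p, U v p ^ 2 * l p ^ m := by
    intro m v
    rw [h m, Matrix.mul_apply]
    refine Finset.sum_congr rfl fun p _ => ?_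
    rw [mul_diagonal, transpose_apply]; ring
  have h1 : ∀ v, ∑ p, U v p ^ 2 = 1 := by
    intro v
    have := hv 0 v
    simpa using this.symm
  rw [trace, Finset.mul_sum, Finset.mul_sum, ← Finset.sum_add_distrib]
  refine Finset.sum_le_sum fun v _ => ?_
  have e : d v ^ (k + 1) = ∑ p, U v p ^ 2 * d v ^ (k + 1) := by
    rw [← Finset.sum_mul, h1, one_mul]
  rw [diag_apply, hv, hv, e, Finset.mul_sum, Finset.mul_sum, Finset.mul_sum,
    ← Finset.sum_add_distrib]
  refine Finset.sum_le_sum fun p _ => ?_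
  have := mul_le_mul_of_nonneg_left (young k (sq_nonneg (l p)) (hd v)) (sq_nonneg (U v p))
  rw [pow_mul, pow_mul]
  linarith

lemma path_sum (m : ℕ) (g : V → V → ℝ) (M : Fin m → Matrix V V ℝ) :
    ∑ f : Fin (m + 1) → V, g (f 0) (f (Fin.last m)) * ∏ i : Fin m, M i (f i.castSucc) (f i.succ) =
      ∑ x, ∑ y, g x y * (List.ofFn M).prod x y := by
  induction m generalizing g with
  | zero =>
    rw [← (Equiv.funUnique (Fin 1) V).symm.sum_comp]
    simp [Matrix.one_apply]
  | succ m ih =>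
    rw [← (Fin.consEquiv (fun _ => V)).sum_comp, Fintype.sum_prod_type, Finset.sum_comm]
    have := ih (fun x' y => ∑ x, g x y * M 0 x x') (fun i => M i.succ)
    trans ∑ f : Fin (m + 1) → V, (∑ x, g x (f (Fin.last m)) * M 0 x (f 0)) *
        ∏ i : Fin m, M i.succ (f i.castSucc) (f i.succ)
    · refine Finset.sum_congr rfl fun f _ => ?_
      rw [Finset.sum_mul]
      refine Finset.sum_congr rfl fun x _ => ?_
      rw [Fin.prod_univ_succ, mul_assoc]
      simp [Fin.consEquiv, ← Fin.succ_last]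
    · rw [this]
      simp only [List.ofFn_succ, List.prod_cons, Matrix.mul_apply, Finset.mul_sum, Finset.sum_mul]
      rw [Finset.sum_comm]
      rw [Finset.sum_comm (s := (Finset.univ : Finset V)) (t := Finset.univ)
        (f := fun x y => ∑ i, g x y * (M 0 x i * (List.ofFn fun i => M i.succ).prod i y))]
      refine Finset.sum_congr rfl fun y _ => ?_
      rw [Finset.sum_comm]
      refine Finset.sum_congr rfl fun y _ => ?_
      refine Finset.sum_congr rfl fun y _ => ?_
      ring

lemma closed_sum (m : ℕ) (M : Fin (m + 1) → Matrix V V ℝ) :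
    ∑ f : Fin (m + 1) → V, ∏ i, M i (f i) (f (i + 1)) = trace (List.ofFn M).prod := by
  have h := path_sum m (fun x y => M (Fin.last m) y x) (fun i => M i.castSucc)
  trans ∑ f : Fin (m + 1) → V, M (Fin.last m) (f (Fin.last m)) (f 0) *
      ∏ i : Fin m, M i.castSucc (f i.castSucc) (f i.succ)
  · refine Finset.sum_congr rfl fun f _ => ?_
    rw [Fin.prod_univ_castSucc, mul_comm]
    simp [Fin.coeSucc_eq_succ]
  · rw [h, List.ofFn_succ_last, List.prod_append, List.prod_singleton, trace]
    refine Finset.sum_congr rfl fun x _ => ?_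
    rw [diag_apply, Matrix.mul_apply]
    refine Finset.sum_congr rfl fun y _ => ?_
    ring

lemma closed_sum_two (m : ℕ) (A B : Matrix V V ℝ) (i j : Fin (m + 1)) (hij : i < j) :
    ∑ f : Fin (m + 1) → V, ∏ t, (if t = i ∨ t = j then B else A) (f t) (f (t + 1)) =
      trace (B * A ^ (j.1 - i.1 - 1) * B * A ^ (m - j.1 + i.1)) := by
  rw [closed_sum m (fun t => if t = i ∨ t = j then B else A)]
  have e : List.ofFn (fun t : Fin (m + 1) => if t = i ∨ t = j then B else A) =
      List.replicate i.1 A ++ (B :: (List.replicate (j.1 - i.1 - 1) A ++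
        (B :: List.replicate (m - j.1) A))) := by
    have hj := j.2
    have hij' : i.1 < j.1 := hij
    apply List.ext_getElem
    · simp; omega
    · intro t h1 h2
      simp only [List.getElem_ofFn, Fin.ext_iff]
      simp only [List.getElem_append, List.getElem_cons, List.getElem_replicate,
        List.length_replicate]
      split_ifs <;> first | rfl | omega
  rw [e]
  simp only [List.prod_append, List.prod_cons, List.prod_replicate]
  rw [trace_mul_comm, pow_add]
  simp only [Matrix.mul_assoc]

lemma closed_sum_one (m : ℕ) (A : Matrix V V ℝ) :
    ∑ f : Fin (m + 1) → V, ∏ t, A (f t) (f (t + 1)) = trace (A ^ (m + 1)) := by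
  rw [closed_sum m (fun _ => A)]
  rw [List.ofFn_const, List.prod_replicate]

lemma exists_cycle {V C : Type*} (n : ℕ) (G : SimpleGraph V) (φ : Sym2 V → C)
    (f : Fin (n + 3) → V) (hf : ∀ i, G.Adj (f i) (f (i + 1))) (hinj : Function.Injective f)
    (hcol : Function.Injective fun i => φ s(f i, f (i + 1))) :
    ∃ (u : V) (w : G.Walk u u), w.IsCycle ∧ w.length = n + 3 ∧ (w.edges.map φ).Nodup := by
  have hadj : ∀ a b, (SimpleGraph.cycleGraph (n + 3)).Adj a b → b = a + 1 ∨ a = b + 1 := by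
    intro a b h
    rw [SimpleGraph.cycleGraph_adj] at h
    rcases h with h | h
    · right; rw [← h]; abel
    · left; rw [← h]; abel
  let F : SimpleGraph.cycleGraph (n + 3) →g G := ⟨f, by
    intro a b h
    rcases hadj a b h with rfl | rfl
    · exact hf _
    · exact (hf _).symm⟩
  have hc := SimpleGraph.cycleGraph.isCycle_cycle (n := n)
  refine ⟨_, (SimpleGraph.cycleGraph.cycle n).map F, hc.map hinj, ?_, ?_⟩
  · rw [SimpleGraph.Walk.length_map, SimpleGraph.cycleGraph.length_cycle]
  · rw [SimpleGraph.Walk.edges_map, List.map_map]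
    refine List.Nodup.map_on ?_ hc.edges_nodup
    have key : ∀ e ∈ (SimpleGraph.cycleGraph.cycle n).edges, ∃ i, e = s(i, i + 1) := by
      intro e he
      have he' := SimpleGraph.Walk.edges_subset_edgeSet _ he
      induction e with
      | _ a b =>
        rcases hadj a b he' with h | h
        · exact ⟨a, by rw [h]⟩
        · exact ⟨b, by rw [h, Sym2.eq_swap]⟩
    intro x hx y hy hxy
    obtain ⟨i, rfl⟩ := key x hx
    obtain ⟨j, rfl⟩ := key y hy
    have : i = j := hcol hxy
    rw [this]


lemma trace_single (X Y : Matrix V V ℝ) (v : V) :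
    trace (single v v 1 * X * single v v 1 * Y) = X v v * Y v v := by
  have : single v v (1 : ℝ) * X * single v v 1 = single v v (X v v) := by
    rw [single_mul_mul_single]; simp
  rw [this, trace]
  simp only [diag_apply, Matrix.mul_apply, single_apply]
  rw [Finset.sum_eq_single v]
  · rw [Finset.sum_eq_single v]
    · simp
    · intro b _ hb; simp [Ne.symm hb]
    · simp
  · intro b _ hb; simp [Ne.symm hb]
  · simp

lemma vertex_ineq (A : Matrix V V ℝ) (hA : Aᵀ = A) (hA0 : ∀ x y, 0 ≤ A x y) (v : V)
    (hv : A v v = 0) (l a b : ℕ) (hab : a + b = 2 * l) :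
    trace (single v v 1 * A * A ^ a * (single v v 1 * A) * A ^ b) ≤
      (A ^ 2) v v * (A ^ (2 * l)) v v := by
  have e1 : trace (single v v 1 * A * A ^ a * (single v v 1 * A) * A ^ b) =
      (A ^ (a + 1)) v v * (A ^ (b + 1)) v v := by
    rw [← trace_single, pow_succ', pow_succ']
    simp only [Matrix.mul_assoc]
  have hnn : ∀ n, ∀ x y, 0 ≤ (A ^ n) x y := by
    intro n
    induction n with
    | zero => intro x y; rw [pow_zero, Matrix.one_apply]; split_ifs <;> norm_num
    | succ n ih =>
      intro x y
      rw [pow_succ, Matrix.mul_apply]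
      exact Finset.sum_nonneg fun z _ => mul_nonneg (ih _ _) (hA0 _ _)
  have h0 : 0 ≤ (A ^ 2) v v * (A ^ (2 * l)) v v := mul_nonneg (hnn _ _ _) (hnn _ _ _)
  rcases a with _ | a
  · rw [e1]; simpa [hv] using h0
  rcases b with _ | b
  · rw [e1]; simpa [hv] using h0
  have hs : (A * single v v 1 * A)ᵀ = A * single v v 1 * A := by
    simp [hA, Matrix.mul_assoc]
  have h := trace_ineq A (A * single v v 1 * A) hA hs a b ⟨l - 1, by omega⟩
  have e2 : trace (A * single v v 1 * A * A ^ a * (A * single v v 1 * A) * A ^ b) =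
      trace (single v v 1 * A ^ (a + 2) * single v v 1 * A ^ (b + 2)) := by
    have := trace_mul_comm A (single v v 1 * A * A ^ a * (A * single v v 1 * A) * A ^ b)
    rw [show a + 2 = 1 + a + 1 by ring, show b + 2 = 1 + b + 1 by ring]
    simp only [pow_add, pow_one, Matrix.mul_assoc] at this ⊢
    exact this
  have e3 : trace (A * single v v 1 * A * (A * single v v 1 * A) * A ^ (a + b)) =
      trace (single v v 1 * A ^ 2 * single v v 1 * A ^ (a + b + 2)) := by
    have := trace_mul_comm A (single v v 1 * A * (A * single v v 1 * A) * A ^ (a + b))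
    rw [show a + b + 2 = 1 + (a + b) + 1 by ring]
    simp only [pow_two, pow_add, pow_one, Matrix.mul_assoc] at this ⊢
    exact this
  rw [e2, e3, trace_single, trace_single] at h
  rw [e1, ← hab]
  rw [show a + 1 + (b + 1) = a + b + 2 by ring]
  exact h

lemma card_pairs (n : ℕ) :
    2 * (Finset.univ.filter fun p : Fin n × Fin n => p.1 < p.2).card ≤ n ^ 2 := by
  have h1 : (Finset.univ.filter fun p : Fin n × Fin n => p.1 < p.2).card =
      (Finset.univ.filter fun p : Fin n × Fin n => p.2 < p.1).card := by
    refine Finset.card_bij (fun p _ => p.swap) ?_ ?_ ?_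
    · simp
    · intro a _ b _ h; exact Prod.swap_injective h
    · intro b hb; exact ⟨b.swap, by simpa using hb, by simp⟩
  have h2 : Disjoint (Finset.univ.filter fun p : Fin n × Fin n => p.1 < p.2)
      (Finset.univ.filter fun p : Fin n × Fin n => p.2 < p.1) := by
    rw [Finset.disjoint_filter]
    intro p _ h h'; exact lt_asymm h h'
  have h3 := Finset.card_le_univ ((Finset.univ.filter fun p : Fin n × Fin n => p.1 < p.2) ∪
      (Finset.univ.filter fun p : Fin n × Fin n => p.2 < p.1))
  rw [Finset.card_union_of_disjoint h2, ← h1] at h3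
  simp only [Fintype.card_prod, Fintype.card_fin] at h3
  rw [pow_two]; omega

open Classical in
lemma edge_ineq {C : Type*} (G : SimpleGraph V) (φ : Sym2 V → C)
    (hφ : ∀ ⦃a b c : V⦄, G.Adj a b → G.Adj a c → b ≠ c → φ s(a, b) ≠ φ s(a, c))
    (A : Matrix V V ℝ) (hA : A = Matrix.of fun x y => if G.Adj x y then 1 else 0)
    (Ac : C → Matrix V V ℝ)
    (hAc : ∀ c, Ac c = Matrix.of fun x y => if G.Adj x y ∧ φ s(x, y) = c then 1 else 0)
    (hsymm : Aᵀ = A)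
    (l a b : ℕ) (hab : a + b = 2 * l) :
    ∑ c ∈ Finset.univ.image φ, trace (Ac c * A ^ a * Ac c * A ^ b) ≤
      ∑ v, (∑ y, A v y) * (A ^ (2 * l)) v v := by
  have hs : ∀ c, (Ac c)ᵀ = Ac c := by
    intro c; ext x y
    simp only [hAc, transpose_apply, of_apply, G.adj_comm y x, Sym2.eq_swap (a := y)]
  have hsq : ∀ c, Ac c * Ac c = diagonal fun x => ∑ y, Ac c x y := by
    intro c; ext x z
    rw [Matrix.mul_apply, diagonal_apply]
    split_ifs with h
    · subst h
      refine Finset.sum_congr rfl fun y _ => ?_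
      have : Ac c y x = Ac c x y := by
        conv_lhs => rw [← hs c]
        rfl
      rw [this, hAc, of_apply]; split_ifs <;> simp
    · refine Finset.sum_eq_zero fun y _ => ?_
      rw [hAc, of_apply, of_apply]
      split_ifs with h1 h2
      · exfalso
        refine hφ h1.1.symm h2.1 h ?_
        rw [h2.2, Sym2.eq_swap, h1.2]
      all_goals simp
  calc ∑ c ∈ Finset.univ.image φ, trace (Ac c * A ^ a * Ac c * A ^ b)
      ≤ ∑ c ∈ Finset.univ.image φ, trace (Ac c * Ac c * A ^ (a + b)) :=
        Finset.sum_le_sum fun c _ => trace_ineq A (Ac c) hsymm (hs c) a b ⟨l, by omega⟩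
    _ = ∑ c ∈ Finset.univ.image φ, ∑ v, (∑ y, Ac c v y) * (A ^ (2 * l)) v v := by
        refine Finset.sum_congr rfl fun c _ => ?_
        rw [hsq, hab, trace]
        refine Finset.sum_congr rfl fun v _ => ?_
        rw [diag_apply, diagonal_mul]
    _ = ∑ v, (∑ y, A v y) * (A ^ (2 * l)) v v := by
        rw [Finset.sum_comm]
        refine Finset.sum_congr rfl fun v _ => ?_
        rw [← Finset.sum_mul, Finset.sum_comm]
        congr 1
        refine Finset.sum_congr rfl fun y _ => ?_
        simp only [hAc, hA, of_apply]
        by_cases h : G.Adj v y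
        · simp [h]
        · simp [h]
    _ ≤ _ := le_refl _

open Classical in
lemma pointwise {C : Type*} (m : ℕ) (hm : 2 ≤ m) (G : SimpleGraph V) (φ : Sym2 V → C)
    (hno : ¬ ∃ (u : V) (w : G.Walk u u), w.IsCycle ∧ w.length = m + 1 ∧
      (w.edges.map φ).Nodup)
    (A : Matrix V V ℝ) (hA : A = Matrix.of fun x y => if G.Adj x y then 1 else 0)
    (Ac : C → Matrix V V ℝ)
    (hAc : ∀ c, Ac c = Matrix.of fun x y => if G.Adj x y ∧ φ s(x, y) = c then 1 else 0)
    (f : Fin (m + 1) → V) :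
    ∏ t, A (f t) (f (t + 1)) ≤
      ∑ p ∈ Finset.univ.filter fun p : Fin (m + 1) × Fin (m + 1) => p.1 < p.2,
        (∑ v, ∏ t, (if t = p.1 ∨ t = p.2 then single v v 1 * A else A) (f t) (f (t + 1)) +
        ∑ c ∈ Finset.univ.image φ,
          ∏ t, (if t = p.1 ∨ t = p.2 then Ac c else A) (f t) (f (t + 1))) := by
  have hA0 : ∀ x y, 0 ≤ A x y := by
    intro x y; rw [hA, of_apply]; split_ifs <;> norm_num
  have hB : ∀ v x y, (single v v (1 : ℝ) * A) x y = if v = x then A x y else 0 := by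
    intro v x y
    rw [Matrix.mul_apply, Finset.sum_eq_single v]
    · by_cases h : v = x
      · subst h; simp
      · simp [h]
    · intro b _ hb; simp [Ne.symm hb]
    · simp
  have hB0 : ∀ v x y, 0 ≤ (single v v (1 : ℝ) * A : Matrix V V ℝ) x y := by
    intro v x y; rw [hB]; split_ifs
    · exact hA0 _ _
    · exact le_rfl
  have hAc0 : ∀ c x y, 0 ≤ Ac c x y := by
    intro c x y; rw [hAc, of_apply]; split_ifs <;> norm_num
  have n1 : ∀ (p : Fin (m + 1) × Fin (m + 1)) v, 0 ≤
      ∏ t, (if t = p.1 ∨ t = p.2 then single v v 1 * A else A) (f t) (f (t + 1)) := by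
    intro p v
    refine Finset.prod_nonneg fun t _ => ?_
    split_ifs
    · exact hB0 _ _ _
    · exact hA0 _ _
  have n2 : ∀ (p : Fin (m + 1) × Fin (m + 1)) c, 0 ≤
      ∏ t, (if t = p.1 ∨ t = p.2 then Ac c else A) (f t) (f (t + 1)) := by
    intro p v
    refine Finset.prod_nonneg fun t _ => ?_
    split_ifs
    · exact hAc0 _ _ _
    · exact hA0 _ _
  have n1s := fun p => Finset.sum_nonneg fun v (_ : v ∈ Finset.univ) => n1 p v
  have n2s := fun p => Finset.sum_nonneg fun c (_ : c ∈ Finset.univ.image φ) => n2 p c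
  have n3 := fun p => add_nonneg (n1s p) (n2s p)
  by_cases hadj : ∀ t, G.Adj (f t) (f (t + 1))
  · have one : ∀ t, A (f t) (f (t + 1)) = 1 := by
      intro t; rw [hA, of_apply, if_pos (hadj t)]
    have hP : ∏ t, A (f t) (f (t + 1)) = 1 := Finset.prod_eq_one fun t _ => one t
    rw [hP]
    have hbad : ∃ i j : Fin (m + 1), i < j ∧
        (f i = f j ∨ φ s(f i, f (i + 1)) = φ s(f j, f (j + 1))) := by
      by_contra hcon
      push Not at hcon
      obtain ⟨n, rfl⟩ : ∃ n, m = n + 2 := ⟨m - 2, by omega⟩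
      refine hno (exists_cycle n G φ f hadj ?_ ?_)
      · intro i j h
        rcases lt_trichotomy i j with hij | hij | hij
        · exact absurd h (hcon i j hij).1
        · exact hij
        · exact absurd h.symm (hcon j i hij).1
      · intro i j h
        rcases lt_trichotomy i j with hij | hij | hij
        · exact absurd h (hcon i j hij).2
        · exact hij
        · exact absurd h.symm (hcon j i hij).2
    obtain ⟨i, j, hij, hb⟩ := hbad
    refine le_trans ?_ (Finset.single_le_sum (fun p _ => n3 p)
      (show (i, j) ∈ _ by simpa using hij))
    rcases hb with hb | hb
    · refine le_trans ?_ (le_add_of_nonneg_right (n2s (i, j)))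
      refine le_trans ?_ (Finset.single_le_sum (fun v _ => n1 (i, j) v) (Finset.mem_univ (f i)))
      refine le_of_eq (Finset.prod_eq_one fun t _ => ?_).symm
      split_ifs with ht
      · rw [hB, if_pos, one]
        rcases ht with rfl | rfl
        · rfl
        · exact hb
      · exact one t
    · refine le_trans ?_ (le_add_of_nonneg_left (n1s (i, j)))
      refine le_trans ?_ (Finset.single_le_sum (fun v _ => n2 (i, j) v)
        (Finset.mem_image_of_mem φ (Finset.mem_univ s(f i, f (i + 1)))))
      refine le_of_eq (Finset.prod_eq_one fun t _ => ?_).symm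
      split_ifs with ht
      · rw [hAc, of_apply, if_pos]
        refine ⟨hadj t, ?_⟩
        rcases ht with rfl | rfl
        · rfl
        · exact hb.symm
      · exact one t
  · push Not at hadj
    obtain ⟨t, ht⟩ := hadj
    rw [Finset.prod_eq_zero (Finset.mem_univ t) (by rw [hA, of_apply, if_neg ht])]
    exact Finset.sum_nonneg fun p _ => n3 p

open Classical in
lemma main_aux {V C : Type*} [Fintype V] (m l : ℕ) (hl : 1 ≤ l) (hm : m + 1 = 2 * (l + 1))
    (G : SimpleGraph V) (φ : Sym2 V → C)
    (hφ : ∀ ⦃a b c : V⦄, G.Adj a b → G.Adj a c → b ≠ c → φ s(a, b) ≠ φ s(a, c))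
    (hno : ¬ ∃ (u : V) (w : G.Walk u u), w.IsCycle ∧ w.length = m + 1 ∧
      (w.edges.map φ).Nodup) :
    Nat.card {v : Fin (m + 1) → V // ∀ i, G.Adj (v i) (v (i + 1))} ≤
      (m + 1) ^ (m + 1) *
        Nat.card {p : V × (Fin (l + 1) → V) // ∀ i, G.Adj p.1 (p.2 i)} := by
  obtain ⟨A, hA⟩ : ∃ A : Matrix V V ℝ, A = Matrix.of fun x y => if G.Adj x y then 1 else 0 :=
    ⟨_, rfl⟩
  obtain ⟨Ac, hAc⟩ : ∃ Ac : C → Matrix V V ℝ,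
      ∀ c, Ac c = Matrix.of fun x y => if G.Adj x y ∧ φ s(x, y) = c then 1 else 0 :=
    ⟨_, fun _ => rfl⟩
  have hsymm : Aᵀ = A := by
    ext x y
    simp only [hA, transpose_apply, of_apply, G.adj_comm y x]
  have hA0 : ∀ x y, 0 ≤ A x y := by
    intro x y; rw [hA, of_apply]; split_ifs <;> norm_num
  have hdiag : ∀ v, A v v = 0 := by intro v; simp [hA]
  have hd : ∀ v, (A ^ 2) v v = ∑ y, A v y := by
    intro v
    rw [pow_two, Matrix.mul_apply]
    refine Finset.sum_congr rfl fun y _ => ?_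
    simp only [hA, of_apply, G.adj_comm y v]
    split_ifs <;> simp
  have hd0 : ∀ v, 0 ≤ ∑ y, A v y := fun v => Finset.sum_nonneg fun y _ => hA0 v y
  have hN : (Nat.card {v : Fin (m + 1) → V // ∀ i, G.Adj (v i) (v (i + 1))} : ℝ) =
      trace (A ^ (m + 1)) := by
    rw [← closed_sum_one, Nat.card_eq_fintype_card, Fintype.card_subtype, Finset.card_filter]
    push_cast
    refine Finset.sum_congr rfl fun f _ => ?_
    simp only [hA, of_apply]
    rw [Finset.prod_ite_zero]
    simp
  have hS : (Nat.card {p : V × (Fin (l + 1) → V) // ∀ i, G.Adj p.1 (p.2 i)} : ℝ) =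
      ∑ v, (∑ y, A v y) ^ (l + 1) := by
    rw [Nat.card_eq_fintype_card, Fintype.card_subtype, Finset.card_filter]
    push_cast
    rw [Fintype.sum_prod_type]
    refine Finset.sum_congr rfl fun v _ => ?_
    rw [Fintype.sum_pow]
    refine Finset.sum_congr rfl fun f _ => ?_
    simp only [hA, of_apply]
    rw [Finset.prod_ite_zero]
    simp
  set T : ℝ := ∑ v, (∑ y, A v y) * (A ^ (2 * l)) v v with hT
  have hcount : trace (A ^ (m + 1)) ≤
      ∑ p ∈ Finset.univ.filter fun p : Fin (m + 1) × Fin (m + 1) => p.1 < p.2, (T + T) := by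
    rw [← closed_sum_one]
    refine (Finset.sum_le_sum fun f _ =>
      pointwise m (by omega) G φ hno A hA Ac hAc f).trans ?_
    rw [Finset.sum_comm]
    refine Finset.sum_le_sum fun p hp => ?_
    have hp' : p.1 < p.2 := by simpa using hp
    have hpv : p.1.1 < p.2.1 := hp'
    have hp2 := p.2.2
    have hab : (p.2.1 - p.1.1 - 1) + (m - p.2.1 + p.1.1) = 2 * l := by omega
    rw [Finset.sum_add_distrib]
    refine add_le_add ?_ ?_
    · rw [Finset.sum_comm]
      refine Finset.sum_le_sum fun v _ => ?_
      rw [closed_sum_two m A _ p.1 p.2 hp', ← hd]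
      exact vertex_ineq A hsymm hA0 v (hdiag v) l _ _ hab
    · rw [Finset.sum_comm]
      simp only [closed_sum_two m A _ p.1 p.2 hp']
      exact edge_ineq G φ hφ A hA Ac hAc hsymm l _ _ hab
  have hT0 : 0 ≤ T := by
    have h0 : ∀ v, 0 ≤ (A ^ (2 * l)) v v := by
      intro v
      rw [two_mul, pow_add, Matrix.mul_apply]
      refine Finset.sum_nonneg fun y _ => ?_
      have : (A ^ l)ᵀ = A ^ l := by rw [transpose_pow, hsymm]
      have h2 : (A ^ l) y v = (A ^ l) v y := by
        conv_lhs => rw [← this]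
        rfl
      rw [h2]; exact mul_self_nonneg _
    exact Finset.sum_nonneg fun v _ => mul_nonneg (hd0 v) (h0 v)
  set K : ℝ := ((m + 1 : ℕ) : ℝ) ^ 2 with hK
  have hNT : trace (A ^ (m + 1)) ≤ K * T := by
    refine hcount.trans ?_
    rw [Finset.sum_const, nsmul_eq_mul]
    have hc : ((2 * (Finset.univ.filter fun p : Fin (m + 1) × Fin (m + 1) =>
        p.1 < p.2).card : ℕ) : ℝ) ≤ (((m + 1) ^ 2 : ℕ) : ℝ) := by
      exact_mod_cast card_pairs (m + 1)
    rw [Nat.cast_pow, ← hK, Nat.cast_mul] at hc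
    have := mul_le_mul_of_nonneg_right hc hT0
    push_cast at this ⊢
    linarith
  have hmom := moment_ineq A hsymm (fun v => K * ∑ y, A v y)
    (fun v => mul_nonneg (by positivity) (hd0 v)) l
  have e1 : ∑ v, K * (∑ y, A v y) * (A ^ (2 * l)) v v = K * T := by
    rw [hT, Finset.mul_sum]
    exact Finset.sum_congr rfl fun v _ => by ring
  have e2 : ∑ v, (K * ∑ y, A v y) ^ (l + 1) = K ^ (l + 1) * ∑ v, (∑ y, A v y) ^ (l + 1) := by
    rw [Finset.mul_sum]
    exact Finset.sum_congr rfl fun v _ => by rw [mul_pow]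
  rw [e1, e2, ← hm] at hmom
  have h3 := mul_le_mul_of_nonneg_left hNT (show (0 : ℝ) ≤ (l : ℝ) + 1 by positivity)
  have fin : trace (A ^ (m + 1)) ≤ K ^ (l + 1) * ∑ v, (∑ y, A v y) ^ (l + 1) := by linarith
  rw [← hN, ← hS, hK, ← pow_mul, ← hm] at fin
  exact_mod_cast fin

end RainbowAux



/-- Let `k ≥ 2` and let `G` be a properly edge-colored graph containing no
rainbow cycle of length `2k`. Then `|Hom(C_{2k}, G)| ≤ (2k)^{2k} · |Hom(S_k, G)|`, where
`Hom(C_{2k}, G)` is identified with the set of closed `2k`-walks `v : ZMod (2k) → V` with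
consecutive vertices adjacent, and `Hom(S_k, G)` with the set of tuples `(v, u₁, …, u_k)` with
each `u_i` adjacent to `v`. -/
theorem hom_cycle_le_hom_star_of_no_rainbow_cycle {V C : Type*} [Fintype V]
    (k : ℕ) (hk : 2 ≤ k) (G : SimpleGraph V) (φ : Sym2 V → C)
    (hφ : ∀ ⦃a b c : V⦄, G.Adj a b → G.Adj a c → b ≠ c → φ s(a, b) ≠ φ s(a, c))
    (hno : ¬ ∃ (u : V) (w : G.Walk u u), w.IsCycle ∧ w.length = 2 * k ∧
      (w.edges.map φ).Nodup) :
    Nat.card {v : ZMod (2 * k) → V // ∀ i, G.Adj (v i) (v (i + 1))} ≤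
      (2 * k) ^ (2 * k) * Nat.card {p : V × (Fin k → V) // ∀ i, G.Adj p.1 (p.2 i)} := by
  have key : ∀ n, n = 2 * k → Nat.card {v : ZMod n → V // ∀ i, G.Adj (v i) (v (i + 1))} ≤
      n ^ n * Nat.card {p : V × (Fin k → V) // ∀ i, G.Adj p.1 (p.2 i)} := by
    intro n hn
    obtain ⟨l, rfl⟩ : ∃ l, k = l + 1 := ⟨k - 1, by omega⟩
    obtain ⟨m, rfl⟩ : ∃ m, n = m + 1 := ⟨n - 1, by omega⟩
    rw [← hn] at hno
    exact RainbowAux.main_aux m l (by omega) hn G φ hφ hno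
  exact key _ rfl
end

section
/- Let k ≥ 2 and let G be a properly edge-colored graph containing no rainbow cycle of length 2k. Let U₁ be the set of closed 2k-walks v₀v₁⋯v_{2k} in G with v₀ = v₂. Then |Hom(C_{2k}, G)| ≤ 4k² · |U₁|. -/
open Matrix in
theorem aux_trace_le {V : Type*} [Fintype V] [DecidableEq V] (A B : Matrix V V ℝ)
    (hA : Aᵀ = A) (hB : Bᵀ = B) (a b : ℕ) (hab : Even (a + b)) :
    trace (B * A ^ a * (B * A ^ b)) ≤ trace (B * B * A ^ (a + b)) := by
  have hA' : A.IsHermitian := by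
    rw [Matrix.IsHermitian, conjTranspose_eq_transpose_of_trivial, hA]
  obtain ⟨U, e, hU, hU', hAe⟩ : ∃ (U : Matrix V V ℝ) (e : V → ℝ), U * Uᵀ = 1 ∧ Uᵀ * U = 1 ∧
      A = U * diagonal e * Uᵀ := by
    refine ⟨hA'.eigenvectorUnitary, hA'.eigenvalues, ?_, ?_, ?_⟩
    · have := Unitary.coe_mul_star_self hA'.eigenvectorUnitary
      simpa [star_eq_conjTranspose] using this
    · have := Unitary.coe_star_mul_self hA'.eigenvectorUnitary
      simpa [star_eq_conjTranspose] using this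
    · have := hA'.spectral_theorem
      rw [Unitary.conjStarAlgAut_apply] at this
      simpa [star_eq_conjTranspose, Function.comp_def] using this
  have hpow : ∀ n, A ^ n = U * diagonal (fun i => e i ^ n) * Uᵀ := by
    intro n
    induction n with
    | zero => simp [hU]
    | succ n ih =>
      rw [pow_succ, ih]
      conv_lhs => rw [hAe]
      calc U * diagonal (fun i => e i ^ n) * Uᵀ * (U * diagonal e * Uᵀ)
          = U * diagonal (fun i => e i ^ n) * (Uᵀ * U) * diagonal e * Uᵀ := by
            simp only [Matrix.mul_assoc]
        _ = _ := by
            rw [hU', Matrix.mul_one, Matrix.mul_assoc U, diagonal_mul_diagonal]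
            simp [pow_succ]
  set Q := Uᵀ * B * U with hQ
  have hQs : ∀ i j, Q i j = Q j i := by
    have : Qᵀ = Q := by simp [hQ, hB, Matrix.mul_assoc]
    intro i j
    conv_lhs => rw [← this]
    rfl
  have key : ∀ a b, trace (B * A ^ a * (B * A ^ b)) = ∑ i, ∑ j, (Q i j) ^ 2 * (e j ^ a * e i ^ b) := by
    intro a b
    rw [hpow, hpow]
    have : trace (B * (U * diagonal (fun i => e i ^ a) * Uᵀ) *
        (B * (U * diagonal (fun i => e i ^ b) * Uᵀ))) =
        trace ((Q * diagonal (fun i => e i ^ a)) * (Q * diagonal (fun i => e i ^ b))) := by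
      rw [hQ]
      simp only [← Matrix.mul_assoc]
      rw [trace_mul_comm]
      simp only [← Matrix.mul_assoc]
    rw [this]
    simp only [trace, diag_apply, mul_apply (M := Q * _), mul_diagonal]
    refine Finset.sum_congr rfl fun i _ => Finset.sum_congr rfl fun j _ => ?_
    rw [hQs j i]; ring
  have h0 := key 0 (a + b)
  rw [pow_zero, Matrix.mul_one, ← Matrix.mul_assoc] at h0
  rw [h0, key]
  have sw : ∀ a b, ∑ i, ∑ j, (Q i j) ^ 2 * (e j ^ a * e i ^ b) =
      ∑ i, ∑ j, (Q i j) ^ 2 * (e j ^ b * e i ^ a) := by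
    intro a b
    rw [Finset.sum_comm]
    refine Finset.sum_congr rfl fun i _ => Finset.sum_congr rfl fun j _ => ?_
    rw [hQs j i]; ring
  have pt : ∀ x y : ℝ, x ^ a * y ^ b + x ^ b * y ^ a ≤ x ^ 0 * y ^ (a + b) + x ^ (a + b) * y ^ 0 := by
    intro x y
    have h1 : x ^ a * y ^ b + x ^ b * y ^ a ≤ |x| ^ a * |y| ^ b + |x| ^ b * |y| ^ a := by
      rw [← abs_pow, ← abs_pow, ← abs_pow, ← abs_pow, ← abs_mul, ← abs_mul]
      exact add_le_add (le_abs_self _) (le_abs_self _)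
    rw [← hab.pow_abs x, ← hab.pow_abs y]
    refine h1.trans ?_
    have hx := abs_nonneg x
    have hy := abs_nonneg y
    generalize |x| = x at *
    generalize |y| = y at *
    have : 0 ≤ (x ^ a - y ^ a) * (x ^ b - y ^ b) := by
      rcases le_total x y with h | h
      · exact mul_nonneg_of_nonpos_of_nonpos (sub_nonpos.2 (pow_le_pow_left₀ hx h _))
          (sub_nonpos.2 (pow_le_pow_left₀ hx h _))
      · exact mul_nonneg (sub_nonneg.2 (pow_le_pow_left₀ hy h _))
          (sub_nonneg.2 (pow_le_pow_left₀ hy h _))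
    rw [pow_add, pow_add]
    nlinarith
  have : ∑ i, ∑ j, (Q i j) ^ 2 * (e j ^ a * e i ^ b) + ∑ i, ∑ j, (Q i j) ^ 2 * (e j ^ b * e i ^ a)
      ≤ ∑ i, ∑ j, (Q i j) ^ 2 * (e j ^ 0 * e i ^ (a+b)) +
        ∑ i, ∑ j, (Q i j) ^ 2 * (e j ^ (a+b) * e i ^ 0) := by
    simp only [← Finset.sum_add_distrib, ← mul_add]
    refine Finset.sum_le_sum fun i _ => Finset.sum_le_sum fun j _ => ?_
    exact mul_le_mul_of_nonneg_left (pt _ _) (sq_nonneg _)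
  rw [sw b a, sw (a+b) 0] at this
  linarith

def auxP {V : Type*} [Fintype V] [DecidableEq V] (M : ℕ → Matrix V V ℝ) : ℕ → Matrix V V ℝ
  | 0 => 1
  | n + 1 => auxP M n * M n

theorem auxP_sum {V : Type*} [Fintype V] [DecidableEq V] (M : ℕ → Matrix V V ℝ) (m : ℕ) :
    ∀ F : V → V → ℝ, ∑ v : Fin (m + 1) → V, (∏ i : Fin m, M i (v i.castSucc) (v i.succ)) *
      F (v 0) (v (Fin.last m)) = ∑ x, ∑ y, auxP M m x y * F x y := by
  induction m with
  | zero =>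
    intro F
    rw [← (Equiv.funUnique (Fin 1) V).symm.sum_comp]
    simp [auxP, Matrix.one_apply]
  | succ m ih =>
    intro F
    rw [← (Fin.snocEquiv (fun _ : Fin (m+2) => V)).sum_comp, Fintype.sum_prod_type, Finset.sum_comm]
    have := ih (fun x y => ∑ z, M m y z * F x z)
    simp only [Fin.snocEquiv, Equiv.coe_fn_mk, Fin.prod_univ_castSucc (n := m), Fin.snoc_castSucc,
      Fin.succ_last, Fin.snoc_last, Fin.succ_castSucc, Fin.val_castSucc, Fin.val_last] 
    have h0 : ∀ (x : V) (v : Fin (m+1) → V), (Fin.snoc v x : Fin (m+2) → V) 0 = v 0 := by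
      intro x v
      exact Fin.snoc_castSucc (α := fun _ => V) x v 0
    simp only [h0]
    simp only [mul_assoc, ← Finset.mul_sum]
    rw [this]
    simp only [auxP, Matrix.mul_apply, Finset.sum_mul, Finset.mul_sum]
    refine Finset.sum_congr rfl fun x _ => ?_
    rw [Finset.sum_comm]
    simp only [mul_assoc]

theorem auxP_trace {V : Type*} [Fintype V] [DecidableEq V] (M : ℕ → Matrix V V ℝ) (m : ℕ) :
    ∑ v : Fin (m + 1) → V, (∏ i : Fin (m + 1), M i (v i) (v (i + 1))) =
      (auxP M (m + 1)).trace := by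
  have := auxP_sum M m (fun x y => M m y x)
  simp only [Fin.prod_univ_castSucc (n := m), Fin.val_castSucc, Fin.val_last, Fin.last_add_one,
    Fin.coeSucc_eq_succ]
  rw [this]
  simp [auxP, Matrix.trace, Matrix.mul_apply]

theorem auxP_special {V : Type*} [Fintype V] [DecidableEq V] (Y A : Matrix V V ℝ) (a b : ℕ) :
    auxP (fun i => if i = 0 ∨ i = a + 1 then Y else A) (a + 1 + (b + 1)) =
      Y * A ^ a * (Y * A ^ b) := by
  have h1 : ∀ j ≤ a, auxP (fun i => if i = 0 ∨ i = a + 1 then Y else A) (j + 1) = Y * A ^ j := by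
    intro j
    induction j with
    | zero => simp [auxP]
    | succ j ih =>
      intro hj
      rw [auxP, ih (by omega), if_neg (by omega), pow_succ, Matrix.mul_assoc]
  induction b with
  | zero => rw [auxP, h1 a le_rfl, if_pos (by omega)]; simp
  | succ b ih => rw [← add_assoc, auxP, ih, if_neg (by omega), pow_succ]; simp only [Matrix.mul_assoc]

theorem aux_walk {V : Type*} (G : SimpleGraph V) (u : ℕ → V) (h : ∀ i, G.Adj (u i) (u (i + 1)))
    (n : ℕ) : ∃ w : G.Walk (u 0) (u n), w.support = (List.range (n + 1)).map u ∧
      w.edges = (List.range n).map (fun i => s(u i, u (i + 1))) := by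
  induction n with
  | zero => exact ⟨.nil, by simp, by simp⟩
  | succ n ih =>
    obtain ⟨w, h1, h2⟩ := ih
    refine ⟨w.concat (h n), ?_, ?_⟩
    · rw [SimpleGraph.Walk.support_concat, h1, List.range_succ (n := n + 1)]; simp
    · rw [SimpleGraph.Walk.edges_concat, h2, List.range_succ (n := n)]; simp

theorem auxP_trace_zmod {V : Type*} [Fintype V] [DecidableEq V] (M : ℕ → Matrix V V ℝ) (m : ℕ) :
    ∑ v : ZMod (m + 1) → V, (∏ i : ZMod (m + 1), M i.val (v i) (v (i + 1))) =
      (auxP M (m + 1)).trace :=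
  auxP_trace M m

open Classical in
theorem aux_count {V κ : Type*} [Fintype V] (G : SimpleGraph V) (g : V → V → κ)
    (a b m : ℕ) (hm : m = a + 1 + b) :
    ((Finset.univ.filter (fun v : ZMod (m + 1) → V => (∀ i, G.Adj (v i) (v (i + 1))) ∧
      g (v 0) (v (0 + 1)) = g (v (a + 1 : ℕ)) (v ((a + 1 : ℕ) + 1)))).card : ℝ) =
    ∑ c ∈ Finset.univ.image (fun p : V × V => g p.1 p.2),
      Matrix.trace ((Matrix.of fun x y => if G.Adj x y ∧ g x y = c then (1 : ℝ) else 0) *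
        (G.adjMatrix ℝ) ^ a * ((Matrix.of fun x y => if G.Adj x y ∧ g x y = c then (1 : ℝ) else 0) *
        (G.adjMatrix ℝ) ^ b)) := by
  have hval : ((a + 1 : ℕ) : ZMod (m + 1)).val = a + 1 := by
    rw [ZMod.val_natCast, Nat.mod_eq_of_lt (by omega)]
  have hprod : ∀ (c : κ) (v : ZMod (m + 1) → V), (∏ i : ZMod (m + 1),
      (if i.val = 0 ∨ i.val = a + 1 then
        (Matrix.of fun x y => if G.Adj x y ∧ g x y = c then (1 : ℝ) else 0) else
          G.adjMatrix ℝ) (v i) (v (i + 1))) =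
      if (∀ i, G.Adj (v i) (v (i + 1))) ∧ g (v 0) (v (0 + 1)) = c ∧
        g (v (a + 1 : ℕ)) (v ((a + 1 : ℕ) + 1)) = c then 1 else 0 := by
    intro c v
    have h1 : ∀ i : ZMod (m + 1), (if i.val = 0 ∨ i.val = a + 1 then
        (Matrix.of fun x y => if G.Adj x y ∧ g x y = c then (1 : ℝ) else 0) else
          G.adjMatrix ℝ) (v i) (v (i + 1)) =
        if G.Adj (v i) (v (i + 1)) ∧ ((i.val = 0 ∨ i.val = a + 1) → g (v i) (v (i + 1)) = c)
          then 1 else 0 := by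
      intro i
      by_cases hi : i.val = 0 ∨ i.val = a + 1
      · rw [if_pos hi, Matrix.of_apply]
        exact if_congr (and_congr_right fun _ => ⟨fun h _ => h, fun h => h hi⟩) rfl rfl
      · rw [if_neg hi, SimpleGraph.adjMatrix_apply]
        exact if_congr ⟨fun h => ⟨h, fun h' => absurd h' hi⟩, fun h => h.1⟩ rfl rfl
    rw [Finset.prod_congr rfl fun i _ => h1 i, Finset.prod_ite_zero]
    simp only [Finset.prod_const_one]
    refine if_congr ?_ rfl rfl
    constructor
    · intro h
      exact ⟨fun i => (h i (Finset.mem_univ _)).1, (h 0 (Finset.mem_univ _)).2 (by simp),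
        (h _ (Finset.mem_univ _)).2 (Or.inr hval)⟩
    · rintro ⟨h, h2, h3⟩ i -
      refine ⟨h i, ?_⟩
      rintro (hi | hi)
      · rw [ZMod.val_eq_zero] at hi
        rw [hi]; exact h2
      · have : i = ((a + 1 : ℕ) : ZMod (m + 1)) := ZMod.val_injective _ (by rw [hi, hval])
        rw [this]; exact h3
  have htr : ∀ c, Matrix.trace ((Matrix.of fun x y => if G.Adj x y ∧ g x y = c then (1 : ℝ) else 0) *
        (G.adjMatrix ℝ) ^ a * ((Matrix.of fun x y => if G.Adj x y ∧ g x y = c then (1 : ℝ) else 0) *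
        (G.adjMatrix ℝ) ^ b)) = ∑ v : ZMod (m + 1) → V,
      if (∀ i, G.Adj (v i) (v (i + 1))) ∧ g (v 0) (v (0 + 1)) = c ∧
        g (v (a + 1 : ℕ)) (v ((a + 1 : ℕ) + 1)) = c then 1 else 0 := by
    intro c
    rw [← auxP_special, show a + 1 + (b + 1) = m + 1 by omega, ← auxP_trace_zmod]
    exact Finset.sum_congr rfl fun v _ => hprod c v
  rw [Finset.sum_congr rfl fun c _ => htr c, Finset.sum_comm, Finset.card_filter]
  push_cast
  refine Finset.sum_congr rfl fun v _ => ?_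
  by_cases h : (∀ i, G.Adj (v i) (v (i + 1))) ∧
      g (v 0) (v (0 + 1)) = g (v (a + 1 : ℕ)) (v ((a + 1 : ℕ) + 1))
  · push_cast at h
    rw [if_pos h, Finset.sum_eq_single (g (v 0) (v (0 + 1)))]
    · rw [if_pos ⟨h.1, rfl, h.2.symm⟩]
    · intro c _ hc
      rw [if_neg]
      exact fun h' => hc h'.2.1.symm
    · intro h'
      exact absurd (Finset.mem_image.2 ⟨(v 0, v (0 + 1)), Finset.mem_univ _, rfl⟩) h'
  · push_cast at h
    rw [if_neg h]
    symm
    refine Finset.sum_eq_zero fun c _ => if_neg fun h' => h ⟨h'.1, h'.2.1.trans h'.2.2.symm⟩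

open Classical in
theorem aux_color {V C : Type*} [Fintype V] (G : SimpleGraph V) (φ : Sym2 V → C)
    (a b N : ℕ) [NeZero N] (hm : N = a + 1 + b + 1) (hev : Even (a + b)) :
    (Finset.univ.filter (fun v : ZMod N → V => (∀ i, G.Adj (v i) (v (i + 1))) ∧
      φ s(v 0, v (0 + 1)) = φ s(v (a + 1 : ℕ), v ((a + 1 : ℕ) + 1)))).card ≤
    (Finset.univ.filter (fun v : ZMod N → V => (∀ i, G.Adj (v i) (v (i + 1))) ∧
      φ s(v 0, v (0 + 1)) = φ s(v (0 + 1 : ℕ), v ((0 + 1 : ℕ) + 1)))).card := by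
  subst hm
  have h1 := aux_count G (fun x y => φ s(x, y)) a b _ rfl
  have h2 := aux_count G (fun x y => φ s(x, y)) 0 (a + b) (a + 1 + b) (by omega)
  rw [← Nat.cast_le (α := ℝ), h1, h2]
  refine Finset.sum_le_sum fun c _ => ?_
  rw [pow_zero, Matrix.mul_one, ← Matrix.mul_assoc (Matrix.of _) (Matrix.of _)]
  refine aux_trace_le _ _ ?_ ?_ a b hev
  · simp
  · ext x y
    simp only [Matrix.transpose_apply, Matrix.of_apply, G.adj_comm y x, Sym2.eq_swap (a := y)]

open Classical in
theorem aux_vertex {V : Type*} [Fintype V] (G : SimpleGraph V)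
    (a b N : ℕ) [NeZero N] (hm : N = (a + 1) + 1 + (b + 1) + 1) (hev : Even (a + b)) :
    (Finset.univ.filter (fun v : ZMod N → V => (∀ i, G.Adj (v i) (v (i + 1))) ∧
      v 0 = v (a + 1 + 1 : ℕ))).card ≤
    (Finset.univ.filter (fun v : ZMod N → V => (∀ i, G.Adj (v i) (v (i + 1))) ∧
      v 0 = v (0 + 1 + 1 : ℕ))).card := by
  subst hm
  have h1 := aux_count G (fun x y => x) (a + 1) (b + 1) _ rfl
  have h2 := aux_count G (fun x y => x) (0 + 1) (a + b + 1) (a + 1 + 1 + (b + 1)) (by omega)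
  rw [← Nat.cast_le (α := ℝ), h1, h2]
  refine Finset.sum_le_sum fun c _ => ?_
  have hY : (Matrix.of fun x y => if G.Adj x y ∧ x = c then (1 : ℝ) else 0) =
      Matrix.single c c 1 * G.adjMatrix ℝ := by
    ext x y
    by_cases h : x = c
    · subst h
      rw [Matrix.single_mul_apply_same, SimpleGraph.adjMatrix_apply, one_mul]
      simp
    · rw [Matrix.single_mul_apply_of_ne (h := h)]
      simp [h]
  rw [hY]
  set A := G.adjMatrix ℝ
  set E : Matrix V V ℝ := Matrix.single c c 1
  have key : ∀ p q : ℕ, Matrix.trace (E * A * A ^ (p + 1) * (E * A * A ^ (q + 1))) =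
      Matrix.trace ((A * E * A) * A ^ p * ((A * E * A) * A ^ q)) := by
    intro p q
    rw [pow_succ, pow_succ]
    have : E * A * (A ^ p * A) * (E * A * (A ^ q * A)) =
      (E * A * A ^ p * A * E * A * A ^ q) * A := by simp only [Matrix.mul_assoc]
    rw [this, Matrix.trace_mul_comm]
    simp only [Matrix.mul_assoc]
  rw [key, key, pow_zero, Matrix.mul_one, ← Matrix.mul_assoc (A * E * A) (A * E * A)]
  have hA : A.transpose = A := by simp [A]
  refine aux_trace_le _ _ hA ?_ a b hev
  simp [Matrix.transpose_mul, hA, E, Matrix.mul_assoc]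

open Classical in
theorem aux_rotate {V : Type*} [Fintype V] (n : ℕ) [NeZero n] (G : SimpleGraph V)
    (P : (ZMod n → V) → Prop) (i : ZMod n) :
    (Finset.univ.filter (fun v : ZMod n → V => (∀ j, G.Adj (v j) (v (j + 1))) ∧
      P (fun j => v (i + j)))).card =
    (Finset.univ.filter (fun v : ZMod n → V => (∀ j, G.Adj (v j) (v (j + 1))) ∧ P v)).card := by
  refine Finset.card_equiv ((Equiv.addLeft (-i)).arrowCongr (Equiv.refl V)) fun v => ?_
  have : ((Equiv.addLeft (-i)).arrowCongr (Equiv.refl V)) v = fun j => v (i + j) := by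
    ext j; simp [Equiv.arrowCongr]
  rw [this]
  simp only [Finset.mem_filter, Finset.mem_univ, true_and]
  refine and_congr_left fun _ => ?_
  constructor
  · intro h j
    rw [← add_assoc]; exact h _
  · intro h j
    have := h (j - i)
    simpa [← add_assoc] using this

theorem aux_exists {V C : Type*} (k : ℕ) (hk : 2 ≤ k) (G : SimpleGraph V) (φ : Sym2 V → C)
    (hno : ¬ ∃ (u : V) (w : G.Walk u u), w.IsCycle ∧ w.length = 2 * k ∧
      (w.edges.map φ).Nodup) (v : ZMod (2 * k) → V) (hv : ∀ i, G.Adj (v i) (v (i + 1))) :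
    ∃ i : ZMod (2 * k), ∃ d ∈ Finset.Icc 1 k, v i = v (i + d) ∨
      φ s(v i, v (i + 1)) = φ s(v (i + d), v (i + d + 1)) := by
  by_contra hcon
  push Not at hcon
  have : NeZero (2 * k) := ⟨by omega⟩
  have hd : ∀ i j : ZMod (2 * k), i ≠ j →
      ∃ d ∈ Finset.Icc 1 k, j = i + (d : ℕ) ∨ i = j + (d : ℕ) := by
    intro i j hij
    have hpos : (j - i).val ≠ 0 := by
      rw [Ne, ZMod.val_eq_zero, sub_eq_zero]; exact hij.symm
    have hlt := ZMod.val_lt (j - i)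
    by_cases h : (j - i).val ≤ k
    · refine ⟨(j - i).val, by simp; omega, Or.inl ?_⟩
      simp
    · refine ⟨2 * k - (j - i).val, by simp; omega, Or.inr ?_⟩
      rw [Nat.cast_sub hlt.le, ZMod.natCast_self]
      simp
  have hinj : Function.Injective v := by
    intro i j h
    by_contra hij
    obtain ⟨d, hdm, rfl | rfl⟩ := hd i j hij
    · exact (hcon _ d hdm).1 h
    · exact (hcon _ d hdm).1 h.symm
  have hinj' : Function.Injective (fun i => φ s(v i, v (i + 1))) := by
    intro i j h
    by_contra hij
    obtain ⟨d, hdm, rfl | rfl⟩ := hd i j hij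
    · exact (hcon _ d hdm).2 h
    · exact (hcon _ d hdm).2 h.symm
  have hcast : ∀ x < 2 * k, ∀ y < 2 * k, (x : ZMod (2 * k)) = y → x = y := by
    intro x hx y hy h
    rw [ZMod.natCast_eq_natCast_iff'] at h
    rwa [Nat.mod_eq_of_lt hx, Nat.mod_eq_of_lt hy] at h
  obtain ⟨w, hs, he⟩ := aux_walk G (fun i : ℕ => v i)
    (fun i => by have := hv i; simpa using this) (2 * k)
  have hcl : v ((2 * k : ℕ) : ZMod (2 * k)) = v ((0 : ℕ) : ZMod (2 * k)) := by simp
  have hw : ∃ w : G.Walk (v (0 : ℕ)) (v (0 : ℕ)),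
      w.support = (List.range (2 * k + 1)).map (fun i : ℕ => v i) ∧
      w.edges = (List.range (2 * k)).map (fun i : ℕ => s(v i, v (i + 1 : ℕ))) :=
    ⟨w.copy rfl hcl, by rw [SimpleGraph.Walk.support_copy]; exact hs,
      by rw [SimpleGraph.Walk.edges_copy]; exact he⟩
  clear hs he
  clear w
  obtain ⟨w, hs, he⟩ := hw
  have hlen : w.length = 2 * k := by
    rw [← SimpleGraph.Walk.length_edges, he]; simp
  have hnd : (w.edges.map φ).Nodup := by
    rw [he, List.map_map]
    refine List.Nodup.map_on ?_ List.nodup_range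
    intro x hx y hy h
    refine hcast x (by simpa using hx) y (by simpa using hy) (hinj' ?_)
    simpa using h
  refine hno ⟨_, w, ?_, hlen, hnd⟩
  rw [SimpleGraph.Walk.isCycle_def]
  refine ⟨⟨List.Nodup.of_map _ hnd⟩, ?_, ?_⟩
  · rintro rfl
    simp at hlen; omega
  · rw [hs, List.range_succ_eq_map, List.map_cons, List.tail_cons, List.map_map]
    refine List.Nodup.map_on ?_ List.nodup_range
    intro x hx y hy h
    refine hcast x (by simpa using hx) y (by simpa using hy) ?_
    have := hinj h
    simpa using this


/-- Let `k ≥ 2` and let `G` be a properly edge-colored graph containing no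
rainbow cycle of length `2k`. Let `U₁` be the set of closed `2k`-walks `v₀v₁⋯v_{2k}` in `G`
with `v₀ = v₂`. Then `|Hom(C_{2k}, G)| ≤ 4k² · |U₁|`. -/
theorem hom_cycle_le_of_no_rainbow_cycle {V C : Type*} [Fintype V]
    (k : ℕ) (hk : 2 ≤ k) (G : SimpleGraph V) (φ : Sym2 V → C)
    (hφ : ∀ ⦃a b c : V⦄, G.Adj a b → G.Adj a c → b ≠ c → φ s(a, b) ≠ φ s(a, c))
    (hno : ¬ ∃ (u : V) (w : G.Walk u u), w.IsCycle ∧ w.length = 2 * k ∧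
      (w.edges.map φ).Nodup) :
    Nat.card {v : ZMod (2 * k) → V // ∀ i, G.Adj (v i) (v (i + 1))} ≤
      4 * k ^ 2 *
        Nat.card {v : ZMod (2 * k) → V // (∀ i, G.Adj (v i) (v (i + 1))) ∧ v 0 = v 2} := by
  classical
  have : NeZero (2 * k) := ⟨by omega⟩
  set U := Nat.card {v : ZMod (2 * k) → V // (∀ i, G.Adj (v i) (v (i + 1))) ∧ v 0 = v 2} with hU
  have hU' : U = (Finset.univ.filter (fun v : ZMod (2 * k) → V =>
      (∀ i, G.Adj (v i) (v (i + 1))) ∧ v 0 = v 2)).card := by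
    rw [hU, Nat.card_eq_fintype_card, Fintype.card_subtype]
  have hV : ∀ d ∈ Finset.Icc 1 k, (Finset.univ.filter (fun v : ZMod (2 * k) → V =>
      (∀ i, G.Adj (v i) (v (i + 1))) ∧ v 0 = v (0 + (d : ℕ)))).card ≤ U := by
    intro d hd
    rw [Finset.mem_Icc] at hd
    rcases Nat.lt_or_ge d 2 with h | h
    · have : d = 1 := by omega
      subst this
      rw [Finset.card_eq_zero.2]
      · exact Nat.zero_le _
      · refine Finset.filter_eq_empty_iff.2 fun v _ hv => ?_
        have h1 := hv.1 0
        have h2 := hv.2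
        rw [Nat.cast_one] at h2
        exact h1.ne h2
    · rw [hU']
      have := aux_vertex G (d - 2) (2 * k - d - 2) (2 * k) (by omega) ⟨k - 2, by omega⟩
      rw [show d - 2 + 1 + 1 = d by omega] at this
      simpa using this
  have hC : ∀ d ∈ Finset.Icc 1 k, (Finset.univ.filter (fun v : ZMod (2 * k) → V =>
      (∀ i, G.Adj (v i) (v (i + 1))) ∧
        φ s(v 0, v (0 + 1)) = φ s(v (0 + (d : ℕ)), v (0 + (d : ℕ) + 1)))).card ≤ U := by
    intro d hd
    rw [Finset.mem_Icc] at hd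
    have := aux_color G φ (d - 1) (2 * k - d - 1) (2 * k) (by omega) ⟨k - 1, by omega⟩
    rw [show d - 1 + 1 = d by omega] at this
    simp only [zero_add] at this ⊢
    refine this.trans ?_
    rw [hU']
    refine Finset.card_le_card fun v hv => ?_
    simp only [Finset.mem_filter, Finset.mem_univ, true_and, Nat.cast_one] at hv ⊢
    refine ⟨hv.1, ?_⟩
    by_contra hne
    have h1 := hv.1 0
    have h2 := hv.1 1
    rw [zero_add] at h1
    rw [one_add_one_eq_two] at h2
    refine hφ h1.symm h2 hne ?_
    rw [Sym2.eq_swap, hv.2, one_add_one_eq_two]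
  have hsub : Finset.univ.filter (fun v : ZMod (2 * k) → V => ∀ i, G.Adj (v i) (v (i + 1))) ⊆
      (Finset.univ ×ˢ Finset.Icc 1 k : Finset (ZMod (2 * k) × ℕ)).biUnion (fun p =>
        Finset.univ.filter (fun v : ZMod (2 * k) → V => (∀ i, G.Adj (v i) (v (i + 1))) ∧
          v (p.1 + 0) = v (p.1 + (0 + (p.2 : ℕ)))) ∪
        Finset.univ.filter (fun v : ZMod (2 * k) → V => (∀ i, G.Adj (v i) (v (i + 1))) ∧
          φ s(v (p.1 + 0), v (p.1 + (0 + 1))) =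
            φ s(v (p.1 + (0 + (p.2 : ℕ))), v (p.1 + (0 + (p.2 : ℕ) + 1))))) := by
    intro v hv
    simp only [Finset.mem_filter, Finset.mem_univ, true_and] at hv
    obtain ⟨i, d, hd, h⟩ := aux_exists k hk G φ hno v hv
    rw [Finset.mem_biUnion]
    refine ⟨(i, d), by simp only [Finset.mem_product, Finset.mem_univ, true_and]; exact hd, ?_⟩
    simp only [Finset.mem_union, Finset.mem_filter, Finset.mem_univ, true_and, zero_add, add_zero]
    rw [← add_assoc]
    exact h.imp (fun h => ⟨hv, h⟩) (fun h => ⟨hv, h⟩)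
  rw [Nat.card_eq_fintype_card, Fintype.card_subtype]
  refine (Finset.card_le_card hsub).trans ?_
  refine (Finset.card_biUnion_le_card_mul _ _ (2 * U) ?_).trans ?_
  · rintro ⟨i, d⟩ hp
    simp only [Finset.mem_product, Finset.mem_univ, true_and] at hp
    refine (Finset.card_union_le _ _).trans ?_
    have e1 := aux_rotate (2 * k) G (fun v => v 0 = v (0 + (d : ℕ))) i
    have e2 := aux_rotate (2 * k) G (fun v =>
      φ s(v 0, v (0 + 1)) = φ s(v (0 + (d : ℕ)), v (0 + (d : ℕ) + 1))) i
    have b1 := hV d hp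
    have b2 := hC d hp
    rw [← e1] at b1
    rw [← e2] at b2
    exact (add_le_add b1 b2).trans (two_mul U).ge
  · rw [Finset.card_product, Finset.card_univ, ZMod.card, Nat.card_Icc, Nat.add_sub_cancel]
    apply le_of_eq
    ring
end

section
/- Let k ≥ 2 and let G be a graph. For 0 ≤ s ≤ k let O_s denote the set of closed 2k-walks v₀v₁⋯v_{2k} in G (with v₀ = v_{2k}) satisfying v₀ = v₂ = ⋯ = v_{2s}. Then the sequence |O_s| is log-convex: for each 1 ≤ s ≤ k−1, |O_s|² ≤ |O_{s−1}| · |O_{s+1}|. -/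
/-- `O_s`: the set of closed `2k`-walks `v₀v₁⋯v_{2k}` in `G` (with `v₀ = v_{2k}`, encoded as
maps `ZMod (2k) → V` with consecutive vertices adjacent) satisfying
`v₀ = v₂ = ⋯ = v_{2s}`. In particular `O₀` is the set of all closed `2k`-walks. -/
def StarDegWalk {V : Type*} (G : SimpleGraph V) (k s : ℕ) : Type _ :=
  {v : ZMod (2 * k) → V // (∀ i, G.Adj (v i) (v (i + 1))) ∧
    ∀ j ≤ s, v ((2 * j : ℕ) : ZMod (2 * k)) = v 0}

open Classical in
/-- number of sequences from `x` to `y` with `n` steps, the `i`-th one in `R i` -/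
noncomputable def seqCount {V : Type*} [Fintype V] (R : ℕ → V → V → Prop) (n : ℕ) (x y : V) : ℕ :=
  ∑ f : Fin (n + 1) → V, if (f 0 = x ∧ f (Fin.last n) = y ∧
    ∀ i : Fin n, R i (f i.castSucc) (f i.succ)) then 1 else 0

open Classical in
theorem seqCount_zero {V : Type*} [Fintype V] (R : ℕ → V → V → Prop) (x y : V) :
    seqCount R 0 x y = if x = y then 1 else 0 := by
  unfold seqCount
  rw [← (Equiv.funUnique (Fin 1) V).symm.sum_comp]
  simp only [Equiv.funUnique_symm_apply, uniqueElim_const, Fin.forall_fin_zero, and_true]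
  rw [Finset.sum_eq_single x]
  · simp
  · intro b _ hb
    simp [hb]
  · simp

open Classical in
theorem seqCount_succ {V : Type*} [Fintype V] (R : ℕ → V → V → Prop) (n : ℕ) (x y : V) :
    seqCount R (n + 1) x y = ∑ z, seqCount R n x z * if R n z y then 1 else 0 := by
  unfold seqCount
  rw [← (Fin.snocEquiv (fun _ : Fin (n + 2) => V)).sum_comp, Fintype.sum_prod_type]
  simp only [Finset.sum_mul]
  rw [Finset.sum_comm, Finset.sum_comm (γ := V)]
  refine Finset.sum_congr rfl fun f _ => ?_
  rw [Finset.sum_eq_single y, Finset.sum_eq_single (f (Fin.last n))]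
  · have h0 : (Fin.snoc f y : Fin (n+2) → V) 0 = f 0 := by
      rw [← Fin.castSucc_zero, Fin.snoc_castSucc]
    simp only [Fin.snocEquiv, Equiv.coe_fn_mk, Fin.forall_fin_succ' (n := n), h0, Fin.snoc_last,
      Fin.snoc_castSucc, Fin.succ_last, Fin.succ_castSucc, Fin.val_castSucc, Fin.val_last]
    by_cases hR : R n (f (Fin.last n)) y <;> simp [hR]
  · intro b _ hb
    rw [if_neg (fun h => hb h.2.1.symm), zero_mul]
  · simp
  · intro b _ hb
    rw [if_neg]
    simp [Fin.snocEquiv, hb]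
  · simp

/-- step relation -/
def stepRel {V : Type*} (G : SimpleGraph V) (s : ℕ) (x : V) (i : ℕ) (a b : V) : Prop :=
  G.Adj a b ∧ ∀ j, j ≤ s → i + 1 = 2 * j → b = x

open Classical in
theorem seqCount_even {V : Type*} [Fintype V] (G : SimpleGraph V) (s : ℕ) (x : V) (j : ℕ)
    (hj : j ≤ s) (y : V) : seqCount (stepRel G s x) (2 * j) x y =
      if x = y then ((G.adjMatrix ℕ ^ 2) x x) ^ j else 0 := by
  induction j generalizing y with
  | zero => simp [seqCount_zero]
  | succ j ih =>
    have ih := ih (by omega)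
    have h1 : ∀ z, seqCount (stepRel G s x) (2 * j + 1) x z =
        ((G.adjMatrix ℕ ^ 2) x x) ^ j * G.adjMatrix ℕ x z := by
      intro z
      rw [seqCount_succ, Finset.sum_eq_single x]
      · have : stepRel G s x (2 * j) x z ↔ G.Adj x z := by
          refine ⟨fun h => h.1, fun h => ⟨h, fun j' _ h' => by omega⟩⟩
        simp [ih, this, SimpleGraph.adjMatrix_apply]
      · intro b _ hb
        simp [ih, hb.symm]
      · simp
    rw [show 2 * (j + 1) = 2 * j + 1 + 1 by ring, seqCount_succ]
    by_cases hxy : x = y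
    · subst hxy
      have : ∀ z, stepRel G s x (2 * j + 1) z x ↔ G.Adj z x :=
        fun z => ⟨fun h => h.1, fun h => ⟨h, fun _ _ _ => rfl⟩⟩
      simp only [h1, this, if_true, pow_succ _ j]
      have hd : (G.adjMatrix ℕ ^ 2) x x = ∑ z, G.adjMatrix ℕ x z * G.adjMatrix ℕ z x := by
        rw [pow_two, Matrix.mul_apply]
      conv_rhs => rw [mul_comm, hd, Finset.sum_mul, ← hd]
      refine Finset.sum_congr rfl fun z _ => ?_
      simp only [SimpleGraph.adjMatrix_apply]
      ring
    · rw [if_neg hxy]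
      refine Finset.sum_eq_zero fun z _ => ?_
      rw [if_neg, mul_zero]
      intro h
      exact hxy (h.2 (j + 1) hj (by ring)).symm

open Classical in
theorem seqCount_add {V : Type*} [Fintype V] (G : SimpleGraph V) (s : ℕ) (x : V) (m : ℕ)
    (y : V) : seqCount (stepRel G s x) (2 * s + m) x y =
      ((G.adjMatrix ℕ ^ 2) x x) ^ s * (G.adjMatrix ℕ ^ m) x y := by
  induction m generalizing y with
  | zero => rw [add_zero, seqCount_even G s x s le_rfl]; simp [Matrix.one_apply]
  | succ m ih =>
    rw [← add_assoc, seqCount_succ, pow_succ _ m, Matrix.mul_apply, Finset.mul_sum]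
    refine Finset.sum_congr rfl fun z _ => ?_
    have : stepRel G s x (2 * s + m) z y ↔ G.Adj z y :=
      ⟨fun h => h.1, fun h => ⟨h, fun _ _ _ => by omega⟩⟩
    simp [ih, this, SimpleGraph.adjMatrix_apply]

open Classical in
theorem card_eq_seq {V : Type*} [Fintype V] (G : SimpleGraph V) (k s : ℕ) (hk : 2 ≤ k)
    (hs : s ≤ k) : Nat.card (StarDegWalk G k s) =
      ∑ x, seqCount (stepRel G s x) (2 * k) x x := by
  have : NeZero (2 * k) := ⟨by omega⟩
  have : Fact (1 < 2 * k) := ⟨by omega⟩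
  have hval : ∀ i : ZMod (2 * k), i.val < 2 * k + 1 := fun i => (ZMod.val_lt i).trans (by omega)
  let T := Σ x : V, {f : Fin (2 * k + 1) → V // f 0 = x ∧ f (Fin.last (2 * k)) = x ∧
    ∀ i : Fin (2 * k), stepRel G s x i (f i.castSucc) (f i.succ)}
  have e : StarDegWalk G k s ≃ T :=
    { toFun := fun v => ⟨v.1 0, fun i => v.1 ((i : ℕ) : ZMod (2 * k)), by simp, by
          simp only [Fin.val_last, ZMod.natCast_self], by
          intro i
          refine ⟨?_, ?_⟩
          · have := v.2.1 ((i : ℕ) : ZMod (2 * k))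
            simpa using this
          · intro j hj h
            have := v.2.2 j hj
            rw [← h] at this
            simpa using this⟩
      invFun := fun p => ⟨fun i => p.2.1 ⟨i.val, hval i⟩, by
          obtain ⟨x, f, h0, hl, hf⟩ := p
          refine ⟨?_, ?_⟩
          · intro i
            have h := (hf ⟨i.val, ZMod.val_lt i⟩).1
            dsimp only
            have h2 : f ⟨(i + 1).val, hval _⟩ = f (Fin.succ ⟨i.val, ZMod.val_lt i⟩) := by
              by_cases hi : i.val + 1 < 2 * k
              · congr 1
                ext
                simp [ZMod.val_add, ZMod.val_one, Nat.mod_eq_of_lt hi]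
              · have hi' : i.val + 1 = 2 * k := by
                  have := ZMod.val_lt i
                  omega
                trans x
                · rw [← h0]; congr 1
                  ext
                  simp [ZMod.val_add, ZMod.val_one, hi']
                · rw [← hl]; congr 1
                  ext
                  simp [hi']
            rw [h2]
            exact h
          · intro j hj
            dsimp only
            have hz : f ⟨(0 : ZMod (2 * k)).val, hval _⟩ = x := by
              rw [← h0]; congr 1; ext; simp
            rw [hz]
            rcases Nat.eq_zero_or_pos j with rfl | hjp
            · rw [← h0]; congr 1; ext; simp
            · by_cases hjk : 2 * j < 2 * k
              · have h := (hf ⟨2 * j - 1, by omega⟩).2 j hj (by simp; omega)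
                rw [← h]; congr 1; ext
                change ((2 * j : ℕ) : ZMod (2 * k)).val = 2 * j - 1 + 1
                rw [ZMod.val_natCast, Nat.mod_eq_of_lt hjk]
                omega
              · have : j = k := by omega
                subst this
                rw [← h0]; congr 1; ext; simp [ZMod.val_natCast]⟩
      left_inv := by
        intro v
        apply Subtype.ext
        funext i
        simp
      right_inv := by
        rintro ⟨x, f, h0, hl, hf⟩
        have hx : f ⟨(0 : ZMod (2 * k)).val, hval _⟩ = x := by
          rw [← h0]; congr 1; ext; simp
        subst hx
        refine Sigma.ext rfl (heq_of_eq (Subtype.ext (funext fun i => ?_)))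
        dsimp only
        by_cases hi : (i : ℕ) < 2 * k
        · congr 1; ext
          simp [ZMod.val_natCast, Nat.mod_eq_of_lt hi]
        · have : i = Fin.last (2 * k) := by ext; simp; omega
          subst this
          rw [hl]; congr 1; ext; simp }
  rw [Nat.card_congr e, Nat.card_sigma]
  refine Finset.sum_congr rfl fun x _ => ?_
  rw [Nat.card_eq_fintype_card, Fintype.card_subtype, Finset.card_filter]
  rfl

open Classical in
theorem card_eq_main {V : Type*} [Fintype V] (G : SimpleGraph V) (k s m : ℕ) (hk : 2 ≤ k)
    (hs : s + m = k) : Nat.card (StarDegWalk G k s) =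
      ∑ x, ((G.adjMatrix ℕ ^ 2) x x) ^ s * (G.adjMatrix ℕ ^ (2 * m)) x x := by
  rw [card_eq_seq G k s hk (by omega)]
  refine Finset.sum_congr rfl fun x _ => ?_
  rw [← seqCount_add, ← hs, mul_add]

theorem sum_cs {ι : Type*} (t : Finset ι) (a b c : ι → ℕ) (h : ∀ i, c i ^ 2 ≤ a i * b i) :
    (∑ i ∈ t, c i) ^ 2 ≤ (∑ i ∈ t, a i) * ∑ i ∈ t, b i := by
  have h1 : ((∑ i ∈ t, (c i : ℝ))) ^ 2 ≤ (∑ i ∈ t, (a i : ℝ)) * ∑ i ∈ t, (b i : ℝ) := by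
    have h2 : (∑ i ∈ t, (c i : ℝ)) ≤ ∑ i ∈ t, √(a i) * √(b i) := by
      refine Finset.sum_le_sum fun i _ => ?_
      rw [← Real.sqrt_mul (by positivity)]
      apply Real.le_sqrt_of_sq_le
      exact_mod_cast h i
    refine (pow_le_pow_left₀ (by positivity) h2 2).trans ?_
    refine (Finset.sum_mul_sq_le_sq_mul_sq _ _ _).trans (le_of_eq ?_)
    simp
  exact_mod_cast h1

open Classical in
theorem pow_diag {V : Type*} [Fintype V] (G : SimpleGraph V) (p q n : ℕ) (h : p + q = n) (x : V) :
    (G.adjMatrix ℕ ^ n) x x = ∑ y, (G.adjMatrix ℕ ^ p) x y * (G.adjMatrix ℕ ^ q) x y := by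
  rw [← h, pow_add, Matrix.mul_apply]
  refine Finset.sum_congr rfl fun y _ => ?_
  congr 1
  conv_rhs => rw [← G.transpose_adjMatrix, ← Matrix.transpose_pow, Matrix.transpose_apply]

/-- Let `k ≥ 2` and let `G` be a graph. Then the sequence `|O_s|`,
`0 ≤ s ≤ k`, is log-convex: for every `1 ≤ s ≤ k−1`, `|O_s|² ≤ |O_{s−1}| · |O_{s+1}|`. -/
theorem starDegWalk_log_convex {V : Type*} [Fintype V] (k : ℕ) (hk : 2 ≤ k)
    (G : SimpleGraph V) (s : ℕ) (hs1 : 1 ≤ s) (hs2 : s ≤ k - 1) :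
    Nat.card (StarDegWalk G k s) ^ 2 ≤
      Nat.card (StarDegWalk G k (s - 1)) * Nat.card (StarDegWalk G k (s + 1)) := by
  classical
  obtain ⟨r, rfl⟩ : ∃ r, s = r + 1 := ⟨s - 1, by omega⟩
  obtain ⟨m, hm⟩ : ∃ m, k = r + 2 + m := ⟨k - (r + 2), by omega⟩
  rw [Nat.add_sub_cancel, card_eq_main G k (r + 1) (m + 1) hk (by omega),
    card_eq_main G k r (m + 2) hk (by omega), card_eq_main G k (r + 1 + 1) m hk (by omega)]
  apply sum_cs
  intro x
  have key : ((G.adjMatrix ℕ ^ (2 * (m + 1))) x x) ^ 2 ≤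
      (G.adjMatrix ℕ ^ (2 * (m + 2))) x x * (G.adjMatrix ℕ ^ (2 * m)) x x := by
    rw [pow_diag G (m + 2) m (2 * (m + 1)) (by ring), pow_diag G (m + 2) (m + 2) _ (by ring),
      pow_diag G m m _ (by ring)]
    apply sum_cs
    intro y
    apply le_of_eq
    ring
  generalize (G.adjMatrix ℕ ^ 2) x x = d
  calc _ = d ^ (2 * r + 2) * ((G.adjMatrix ℕ ^ (2 * (m + 1))) x x) ^ 2 := by ring
    _ ≤ d ^ (2 * r + 2) * _ := Nat.mul_le_mul_left _ key
    _ = _ := by ring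
end

section
/- Let k ≥ 2 and let G be a properly edge-colored n-vertex graph with edge density p = 2e(G)/n². If |Hom(S_k, G)| ≤ 10·n^{k+1}·p^k and G contains no rainbow cycle of length 2k, then e(G) ≤ 2·10^{1/k}·k²·n^{1+1/k}. -/
open Finset Matrix

noncomputable def mp {V : Type*} [Fintype V] [DecidableEq V] (M : ℕ → Matrix V V ℝ) : ℕ → Matrix V V ℝ
  | 0 => 1
  | n+1 => mp M n * M n

lemma mp_expand {V : Type*} [Fintype V] [DecidableEq V] (M : ℕ → Matrix V V ℝ) (m : ℕ) (u v : V) :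
    mp M m u v = ∑ x : Fin (m+1) → V, if x 0 = u ∧ x (Fin.last m) = v then
      ∏ i : Fin m, M i (x i.castSucc) (x i.succ) else 0 := by
  induction m generalizing v with
  | zero =>
    rw [← (Equiv.funUnique (Fin 1) V).symm.sum_comp]
    simp only [mp, Matrix.one_apply]
    simp [ite_and]
  | succ m ih =>
    rw [← (Fin.snocEquiv (fun _ => V)).sum_comp, Fintype.sum_prod_type]
    simp only [mp, Matrix.mul_apply, ih, Finset.sum_mul]
    rw [Finset.sum_comm]
    rw [Finset.sum_comm (s := (univ : Finset V))]
    refine Finset.sum_congr rfl fun x _ => ?_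
    have h0 : ∀ y : V, (Fin.snoc x y : Fin (m+2) → V) 0 = x 0 := fun y => by
      have := Fin.snoc_castSucc (α := fun _ => V) y x 0
      exact this
    simp only [Fin.snocEquiv, Equiv.coe_fn_mk, h0, Fin.snoc_last, Fin.prod_univ_castSucc,
      Fin.snoc_castSucc, Fin.succ_castSucc, Fin.val_castSucc, Fin.succ_last, Fin.val_last]
    by_cases hu : x 0 = u
    · simp only [hu, true_and]
      rw [Finset.sum_eq_single (x (Fin.last m)), Finset.sum_eq_single v]
      · simp
      · intro b _ hb; simp [hb]
      · simp
      · intro b _ hb; simp [hb.symm]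
      · simp
    · simp [hu]

lemma mp_trace {V : Type*} [Fintype V] [DecidableEq V] (M : ℕ → Matrix V V ℝ) (m : ℕ) :
    (mp M m).trace = ∑ x : Fin (m+1) → V, if x 0 = x (Fin.last m) then
      ∏ i : Fin m, M i (x i.castSucc) (x i.succ) else 0 := by
  simp only [Matrix.trace, Matrix.diag, mp_expand]
  rw [Finset.sum_comm]
  refine Finset.sum_congr rfl fun x _ => ?_
  rw [Finset.sum_eq_single (x 0)]
  · simp [eq_comm]
  · intro b _ hb; simp [hb.symm]
  · simp

lemma mp_const {V : Type*} [Fintype V] [DecidableEq V] (M : ℕ → Matrix V V ℝ) (A : Matrix V V ℝ) (m : ℕ)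
    (h : ∀ t < m, M t = A) : mp M m = A ^ m := by
  induction m with
  | zero => simp [mp]
  | succ m ih => rw [mp, ih (fun t ht => h t (by omega)), h m (by omega), pow_succ]

lemma mp_add {V : Type*} [Fintype V] [DecidableEq V] (M : ℕ → Matrix V V ℝ) (a b : ℕ) :
    mp M (a+b) = mp M a * mp (fun t => M (a + t)) b := by
  induction b with
  | zero => simp [mp]
  | succ b ih => rw [← add_assoc, mp, ih, mp, mul_assoc]

lemma mp_two {V : Type*} [Fintype V] [DecidableEq V] (A B : Matrix V V ℝ) (i l r : ℕ) :
    mp (fun t => if t = i ∨ t = i + 1 + l then B else A) (i + 1 + l + 1 + r) =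
      A ^ i * B * A ^ l * B * A ^ r := by
  rw [mp_add, mp, mp_add, mp]
  rw [mp_const _ A i, mp_const _ A l, mp_const _ A r]
  · simp
  · intro t ht; rw [if_neg]; omega
  · intro t ht; rw [if_neg]; omega
  · intro t ht; rw [if_neg]; omega

lemma mp_two_trace {V : Type*} [Fintype V] [DecidableEq V] (A B : Matrix V V ℝ) (i j m : ℕ) (hij : i < j) (hj : j < m) :
    (mp (fun t => if t = i ∨ t = j then B else A) m).trace =
      (B * A ^ (j - i - 1) * B * A ^ (m - 1 - (j - i))).trace := by
  obtain ⟨l, rfl⟩ : ∃ l, j = i + 1 + l := ⟨j - i - 1, by omega⟩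
  obtain ⟨r, rfl⟩ : ∃ r, m = i + 1 + l + 1 + r := ⟨m - (i+1+l) - 1, by omega⟩
  rw [mp_two]
  have h1 : i + 1 + l - i - 1 = l := by omega
  have h2 : i + 1 + l + 1 + r - 1 - (i + 1 + l - i) = r + i := by omega
  rw [h1, h2, pow_add]
  rw [mul_assoc (A ^ i), mul_assoc (A^i), mul_assoc (A^i), Matrix.trace_mul_comm]
  simp only [mul_assoc]

lemma exists_spec {V : Type*} [Fintype V] [DecidableEq V] (A : Matrix V V ℝ) (hA : A.IsSymm) :
    ∃ (U : Matrix V V ℝ) (l : V → ℝ), U * Uᵀ = 1 ∧ Uᵀ * U = 1 ∧ 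
      ∀ n, A ^ n = U * diagonal (fun i => l i ^ n) * Uᵀ := by
  have hH : A.IsHermitian := by
    rw [Matrix.IsHermitian, Matrix.conjTranspose_eq_transpose_of_trivial]; exact hA
  refine ⟨hH.eigenvectorUnitary, hH.eigenvalues, ?_, ?_, ?_⟩
  · have := Unitary.coe_mul_star_self hH.eigenvectorUnitary
    rwa [Unitary.coe_star, Matrix.star_eq_conjTranspose, Matrix.conjTranspose_eq_transpose_of_trivial] at this
  · have := Unitary.coe_star_mul_self hH.eigenvectorUnitary
    rwa [Matrix.star_eq_conjTranspose, Matrix.conjTranspose_eq_transpose_of_trivial] at this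
  · have h2 := Unitary.coe_star_mul_self hH.eigenvectorUnitary
    have h1 := Unitary.coe_mul_star_self hH.eigenvectorUnitary
    rw [Unitary.coe_star] at h1
    rw [Matrix.star_eq_conjTranspose, Matrix.conjTranspose_eq_transpose_of_trivial] at h1 h2
    have h := hH.spectral_theorem
    rw [Unitary.conjStarAlgAut_apply, Matrix.star_eq_conjTranspose, Matrix.conjTranspose_eq_transpose_of_trivial] at h
    generalize (hH.eigenvectorUnitary : Matrix V V ℝ) = U at *
    intro n
    induction n with
    | zero => simp [h1]
    | succ n ih =>
      rw [pow_succ, ih]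
      nth_rw 2 [h]
      have : U * diagonal (fun i => hH.eigenvalues i ^ n) * Uᵀ * (U * diagonal (RCLike.ofReal ∘ hH.eigenvalues) * Uᵀ) = U * diagonal (fun i => hH.eigenvalues i ^ n) * (Uᵀ * U) * diagonal (RCLike.ofReal ∘ hH.eigenvalues) * Uᵀ := by
        simp only [mul_assoc]
      rw [this, h2, mul_one, mul_assoc U, diagonal_mul_diagonal]
      simp [pow_succ]

lemma rearr (x y : ℝ) (hx : 0 ≤ x) (hy : 0 ≤ y) (c a b : ℕ) :
    x^(c+a) * y^(c+b) + x^(c+b)*y^(c+a) ≤ x^c*y^(c+a+b) + x^(c+a+b)*y^c := by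
  have key : 0 ≤ (x^a - y^a)*(x^b-y^b) := by
    rcases le_total x y with h | h
    · exact mul_nonneg_of_nonpos_of_nonpos (sub_nonpos.2 (pow_le_pow_left₀ hx h a)) (sub_nonpos.2 (pow_le_pow_left₀ hx h b))
    · exact mul_nonneg (sub_nonneg.2 (pow_le_pow_left₀ hy h a)) (sub_nonneg.2 (pow_le_pow_left₀ hy h b))
  have := mul_nonneg (mul_nonneg (pow_nonneg hx c) (pow_nonneg hy c)) key
  simp only [pow_add]
  nlinarith

lemma young (a y : ℝ) (ha : 0 ≤ a) (hy : 0 ≤ y) (n : ℕ) :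
    (n+1) * (a * y^n) ≤ a^(n+1) + n * y^(n+1) := by
  induction n with
  | zero => simp
  | succ n ih =>
    have h1 := rearr a y ha hy 0 1 (n+1)
    have h2 := mul_le_mul_of_nonneg_left ih hy
    push_cast
    simp only [pow_succ, pow_add, pow_zero, zero_add, one_mul, mul_one] at *
    nlinarith

lemma weight_sum {V : Type*} [Fintype V] (W : V → V → ℝ) (hW : ∀ i j, 0 ≤ W i j) (hs : ∀ i j, W i j = W j i)
    (l : V → ℝ) (c a b : ℕ) (he : Even (c + (c+a+b))) (hc : Even c) :
    ∑ i, ∑ j, W i j * (l i ^ (c+a) * l j ^ (c+b)) ≤ ∑ i, ∑ j, W i j * (l i ^ c * l j ^ (c+a+b)) := by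
  have sw : ∀ f : V → V → ℝ, ∑ i, ∑ j, W i j * f i j = ∑ i, ∑ j, W i j * f j i := fun f => by
    rw [Finset.sum_comm]
    exact Finset.sum_congr rfl fun i _ => Finset.sum_congr rfl fun j _ => by rw [hs]
  have hd : Even (c+a+b) := by rcases he with ⟨r, hr⟩; rcases hc with ⟨s, hs⟩; exact ⟨r - s, by omega⟩
  have h1 : ∑ i, ∑ j, W i j * (l i ^ (c+a) * l j ^ (c+b)) + ∑ i, ∑ j, W i j * (l j ^ (c+a) * l i ^ (c+b))
    ≤ ∑ i, ∑ j, W i j * (l i ^ c * l j ^ (c+a+b)) + ∑ i, ∑ j, W i j * (l j ^ c * l i ^ (c+a+b)) := by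
    simp only [← Finset.sum_add_distrib]
    refine Finset.sum_le_sum fun i _ => Finset.sum_le_sum fun j _ => ?_
    rw [← mul_add, ← mul_add]
    refine mul_le_mul_of_nonneg_left ?_ (hW i j)
    have := rearr |l i| |l j| (abs_nonneg _) (abs_nonneg _) c a b
    rw [hc.pow_abs, hd.pow_abs, hc.pow_abs, hd.pow_abs] at this
    have e1 : l i ^ (c+a) * l j ^ (c+b) ≤ |l i| ^ (c+a) * |l j| ^ (c+b) := by
      rw [← abs_pow, ← abs_pow, ← abs_mul]; exact le_abs_self _
    have e2 : l j ^ (c+a) * l i ^ (c+b) ≤ |l i| ^ (c+b) * |l j| ^ (c+a) := by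
      rw [← abs_pow, ← abs_pow, ← abs_mul, mul_comm]; exact le_abs_self _
    linarith
  rw [← sw (fun i j => l i ^ (c+a) * l j ^ (c+b)), ← sw (fun i j => l i ^ c * l j ^ (c+a+b))] at h1
  linarith

lemma trace_form {V : Type*} [Fintype V] [DecidableEq V] (A U B : Matrix V V ℝ) (l : V → ℝ) (hB : B.IsSymm)
     (h : ∀ n, A ^ n = U * diagonal (fun i => l i ^ n) * Uᵀ) (a b : ℕ) :
    (B * A ^ a * B * A ^ b).trace = ∑ i, ∑ j, ((Uᵀ * B * U) i j)^2 * (l i ^ a * l j ^ b) := by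
  have e : (B * A ^ a * B * A ^ b).trace =
     (((Uᵀ * B * U) * diagonal (fun i => l i ^ a)) * ((Uᵀ * B * U) * diagonal (fun i => l i ^ b))).trace := by
    rw [h, h, Matrix.trace_mul_comm]
    have : U * diagonal (fun i => l i ^ b) * Uᵀ * (B * (U * diagonal (fun i => l i ^ a) * Uᵀ) * B)
      = (U * diagonal (fun i => l i ^ b)) * (Uᵀ * B * U * diagonal (fun i => l i ^ a) * Uᵀ * B) := by
      simp only [mul_assoc]
    rw [this, Matrix.trace_mul_comm]
    simp only [mul_assoc]
  have hs : ∀ i j, (Uᵀ * B * U) i j = (Uᵀ * B * U) j i := by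
    have : (Uᵀ * B * U)ᵀ = Uᵀ * B * U := by
      simp [Matrix.transpose_mul, hB.eq, mul_assoc]
    intro i j
    conv_lhs => rw [← this]
    rfl
  rw [e]
  simp only [Matrix.trace, Matrix.diag, Matrix.mul_apply (M := _ * diagonal _), Matrix.mul_diagonal]
  rw [Finset.sum_comm]
  refine Finset.sum_congr rfl fun i _ => Finset.sum_congr rfl fun j _ => ?_
  rw [hs j i]; ring

lemma trace_le {V : Type*} [Fintype V] [DecidableEq V] (A B : Matrix V V ℝ) (hA : A.IsSymm) (hB : B.IsSymm)
    (c a b : ℕ) (he : Even (c + (c+a+b))) (hc : Even c) :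
    (B * A ^ (c+a) * B * A ^ (c+b)).trace ≤ (B * A ^ c * B * A ^ (c+a+b)).trace := by
  obtain ⟨U, l, h1, h2, h⟩ := exists_spec A hA
  rw [trace_form A U B l hB h, trace_form A U B l hB h]
  refine weight_sum _ (fun i j => sq_nonneg _) ?_ l c a b he hc
  have hs : ∀ i j, (Uᵀ * B * U) i j = (Uᵀ * B * U) j i := by
    have : (Uᵀ * B * U)ᵀ = Uᵀ * B * U := by
      simp [Matrix.transpose_mul, hB.eq, mul_assoc]
    intro i j
    conv_lhs => rw [← this]
    rfl
  intro i j; rw [hs]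

lemma walk_of {V : Type*} (G : SimpleGraph V) (x : ℕ → V) (m : ℕ) (h : ∀ i < m, G.Adj (x i) (x (i+1))) :
    ∃ w : G.Walk (x 0) (x m), w.length = m ∧ w.support = (List.range (m+1)).map x ∧
      w.edges = (List.range m).map (fun i => s(x i, x (i+1))) := by
  induction m with
  | zero => exact ⟨SimpleGraph.Walk.nil, by simp⟩
  | succ m ih =>
    obtain ⟨w, h1, h2, h3⟩ := ih (fun i hi => h i (by omega))
    refine ⟨w.concat (h m (by omega)), by simp [h1], ?_, ?_⟩
    · rw [SimpleGraph.Walk.support_concat, h2, List.range_succ (n := m+1)]; simp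
    · rw [SimpleGraph.Walk.edges_concat, h3, List.range_succ]; simp

lemma ndmap {D : Type*} (m : ℕ) (f : ℕ → D) (hf : ∀ i j, i < j → j < m → f i ≠ f j) :
    ((List.range m).map f).Nodup := by
  refine (List.nodup_map_iff_inj_on List.nodup_range).2 ?_
  intro i hi j hj hij
  rw [List.mem_range] at hi hj
  rcases lt_trichotomy i j with h | h | h
  · exact absurd hij (hf i j h hj)
  · exact h
  · exact absurd hij.symm (hf j i h hi)

lemma fail_of {V C : Type*} (G : SimpleGraph V) (φ : Sym2 V → C) (m : ℕ) (hm : 0 < m)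
    (hno : ¬ ∃ (u : V) (w : G.Walk u u), w.IsCycle ∧ w.length = m ∧ (w.edges.map φ).Nodup)
    (x : ℕ → V) (h : ∀ i < m, G.Adj (x i) (x (i+1))) (hx : x 0 = x m) :
    ∃ i j, i < j ∧ j < m ∧ (x (i+1) = x (j+1) ∨ φ s(x i, x (i+1)) = φ s(x j, x (j+1))) := by
  by_contra hcon
  push Not at hcon
  obtain ⟨w, h1, h2, h3⟩ := walk_of G x m h
  have hc : (w.edges.map φ).Nodup := by
    rw [h3, List.map_map]
    exact ndmap m _ (fun i j hij hj => (hcon i j hij hj).2)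
  apply hno
  refine ⟨x 0, w.copy rfl hx.symm, ?_, by simp [h1], by simpa using hc⟩
  rw [SimpleGraph.Walk.isCycle_def]
  refine ⟨⟨?_⟩, ?_, ?_⟩
  · simpa using hc.of_map
  · intro h
    have := congrArg SimpleGraph.Walk.length h
    simp [h1] at this; omega
  · rw [SimpleGraph.Walk.support_copy, h2, List.range_succ_eq_map]
    simp only [List.map_cons, List.tail_cons, List.map_map]
    exact ndmap m _ (fun i j hij hj => (hcon i j hij hj).1)

lemma eig_lower {V : Type*} [Fintype V] [DecidableEq V] [Nonempty V] (A U : Matrix V V ℝ) (l : V → ℝ)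
    (h1 : U * Uᵀ = 1) (h : ∀ n, A ^ n = U * diagonal (fun i => l i ^ n) * Uᵀ) (D : ℝ) (hD : 0 ≤ D)
    (hA : ∑ u, ∑ v, A u v = Fintype.card V * D) (m : ℕ) : D ^ (2*m) ≤ ∑ i, l i ^ (2*m) := by
  have key : ∀ n, ∑ u, ∑ v, (A ^ n) u v = ∑ i, (∑ u, U u i)^2 * l i ^ n := by
    intro n
    rw [h]
    simp only [Matrix.mul_apply (N := Uᵀ), Matrix.mul_diagonal, Matrix.transpose_apply]
    have : ∀ u, ∑ v, ∑ i, U u i * l i ^ n * U v i = ∑ i, U u i * l i ^ n * ∑ v, U v i := by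
      intro u; rw [Finset.sum_comm]; simp only [Finset.mul_sum]
    simp only [this]
    rw [Finset.sum_comm]
    refine Finset.sum_congr rfl fun i _ => ?_
    rw [← Finset.sum_mul, ← Finset.sum_mul]; ring
  have k0 := key 0
  have k1 := key 1
  simp only [pow_one, pow_zero, mul_one] at k0 k1
  rw [hA] at k1
  have k0' : (Fintype.card V : ℝ) = ∑ i, (∑ u, U u i)^2 := by
    rw [← k0]; simp [Matrix.one_apply]
  have hn : (0:ℝ) < Fintype.card V := by exact_mod_cast Fintype.card_pos
  obtain ⟨i, hi⟩ : ∃ i, D ≤ l i := by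
    by_contra hcon
    push Not at hcon
    have hz : ∑ i, (∑ u, U u i)^2 * (D - l i) = 0 := by
      simp only [mul_sub, Finset.sum_sub_distrib]
      rw [← k1, ← Finset.sum_mul, ← k0']; ring
    rw [Finset.sum_eq_zero_iff_of_nonneg (fun i _ => mul_nonneg (sq_nonneg _) (sub_nonneg.2 (hcon i).le))] at hz
    have : ∑ i, (∑ u, U u i)^2 = 0 := Finset.sum_eq_zero fun i hi => by
      rcases mul_eq_zero.1 (hz i hi) with h | h
      · exact h
      · linarith [hcon i]
    linarith
  calc D ^ (2*m) ≤ l i ^ (2*m) := pow_le_pow_left₀ hD hi _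
    _ ≤ _ := Finset.single_le_sum (f := fun i => l i ^ (2*m)) (fun i _ => (even_two_mul m).pow_nonneg _) (Finset.mem_univ i)

lemma T_bound {V : Type*} [Fintype V] [DecidableEq V] (A U : Matrix V V ℝ) (l : V → ℝ)
    (h1 : U * Uᵀ = 1) (h2 : Uᵀ * U = 1) (h : ∀ n, A ^ n = U * diagonal (fun i => l i ^ n) * Uᵀ)
    (d : V → ℝ) (hd : ∀ v, 0 ≤ d v) (q : ℝ) (hq : 0 ≤ q) (n : ℕ) :
    (n+1) * (q * ∑ v, d v * (A ^ (2*n)) v v) ≤ q^(n+1) * ∑ v, d v ^ (n+1) + n * ∑ i, l i ^ (2*(n+1)) := by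
  have e : ∀ n v, (A ^ n) v v = ∑ i, U v i ^ 2 * l i ^ n := by
    intro n v
    rw [h]
    simp only [Matrix.mul_apply (N := Uᵀ), Matrix.mul_diagonal, Matrix.transpose_apply]
    exact Finset.sum_congr rfl fun i _ => by ring
  have r1 : ∀ v, ∑ i, U v i ^ 2 = 1 := by
    intro v; have := e 0 v; simpa using this.symm
  have r2 : ∀ i, ∑ v, U v i ^ 2 = 1 := by
    intro i; have := congrFun (congrFun h2 i) i
    simpa [Matrix.mul_apply, sq] using this
  have t1 : q^(n+1) * ∑ v, d v ^ (n+1) = ∑ v, ∑ i, U v i ^ 2 * (q * d v)^(n+1) := by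
    simp only [← Finset.sum_mul, r1, one_mul, mul_pow, Finset.mul_sum]
  have t2 : n * ∑ i, l i ^ (2*(n+1)) = ∑ v, ∑ i, U v i ^ 2 * (n * (l i ^ 2)^(n+1)) := by
    rw [Finset.sum_comm]
    simp only [← Finset.sum_mul, r2, one_mul, ← Finset.mul_sum, pow_mul]
  rw [t1, t2, ← Finset.sum_add_distrib]
  simp only [e, Finset.mul_sum, ← Finset.sum_add_distrib]
  refine Finset.sum_le_sum fun v _ => Finset.sum_le_sum fun i _ => ?_
  have := mul_le_mul_of_nonneg_left (young (q * d v) (l i ^ 2) (mul_nonneg hq (hd v)) (sq_nonneg _) n) (sq_nonneg (U v i))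
  rw [pow_mul]
  linarith

lemma trace_single {V : Type*} [Fintype V] [DecidableEq V] (M N : Matrix V V ℝ) (v : V) :
    (Matrix.single v v 1 * M * Matrix.single v v 1 * N).trace = M v v * N v v := by
  rw [mul_assoc, Matrix.trace]
  simp only [Matrix.diag, Matrix.mul_apply (M := _ * M)]
  simp [Matrix.mul_apply, Matrix.single_apply, ite_and]

section
variable {V C : Type*} [Fintype V] [DecidableEq V] [DecidableEq C] (G : SimpleGraph V) [DecidableRel G.Adj]

noncomputable def colM (φ : Sym2 V → C) (c : C) : Matrix V V ℝ :=
  Matrix.of fun u v => if G.Adj u v ∧ φ s(u, v) = c then 1 else 0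

noncomputable def verM (v : V) : Matrix V V ℝ := G.adjMatrix ℝ * Matrix.single v v 1

lemma verM_apply (v a b : V) : verM G v a b = if G.Adj a b ∧ b = v then 1 else 0 := by
  simp [verM, Matrix.mul_apply, Matrix.single_apply, ite_and, SimpleGraph.adjMatrix_apply]
  grind

lemma colM_symm (φ : Sym2 V → C) (c : C) : (colM G φ c).IsSymm := by
  ext u v
  simp [colM, SimpleGraph.adj_comm, Sym2.eq_swap]

lemma diag_nonneg (n : ℕ) (v : V) : 0 ≤ (G.adjMatrix ℝ ^ n) v v := by
  rw [SimpleGraph.adjMatrix_pow_apply_eq_card_walk]; positivity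

lemma ver_bound (k : ℕ) (hk : 2 ≤ k) (i j : ℕ) (hij : i < j) (hj : j < 2*k) :
    ∑ v, (mp (fun t => if t = i ∨ t = j then verM G v else G.adjMatrix ℝ) (2*k)).trace ≤
     ∑ v, (G.degree v : ℝ) * (G.adjMatrix ℝ ^ (2*(k-1))) v v := by
  refine Finset.sum_le_sum fun v _ => ?_
  rw [mp_two_trace _ _ _ _ _ hij hj, verM]
  set A := G.adjMatrix ℝ with hA
  set E : Matrix V V ℝ := Matrix.single v v 1 with hE
  have hd : (G.degree v : ℝ) = (A ^ 2) v v := by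
    rw [sq, SimpleGraph.adjMatrix_mul_self_apply_self]
  obtain ⟨l, hl⟩ : ∃ l, l = j - i - 1 := ⟨_, rfl⟩
  obtain ⟨r, hr⟩ : ∃ r, r = 2 * k - 1 - (j - i) := ⟨_, rfl⟩
  rw [← hl, ← hr]
  have e : (A * E * A ^ l * (A * E) * A ^ r).trace = (E * A ^ (l+1) * E * A ^ (r+1)).trace := by
    have : A * E * A ^ l * (A * E) * A ^ r = A * (E * (A ^ l * A) * E * A ^ r) := by
      simp only [mul_assoc]
    rw [this, Matrix.trace_mul_comm, pow_succ, pow_succ]; simp only [mul_assoc]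
  rw [e]
  rcases Nat.eq_zero_or_pos l with h0 | hl0
  · rw [h0, trace_single, hd]
    have : (A ^ (0+1)) v v = 0 := by simp [hA]
    rw [this, zero_mul]
    exact mul_nonneg (diag_nonneg G _ _) (diag_nonneg G _ _)
  rcases Nat.eq_zero_or_pos r with h0 | hr0
  · rw [h0, trace_single, hd]
    have : (A ^ (0+1)) v v = 0 := by simp [hA]
    rw [this, mul_zero]
    exact mul_nonneg (diag_nonneg G _ _) (diag_nonneg G _ _)
  have := trace_le A E (SimpleGraph.isSymm_adjMatrix G) (by rw [hE]; ext a b; simp [Matrix.single_apply, and_comm]) 2 (l-1) (r-1)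
    ⟨k, by omega⟩ even_two
  rw [trace_single (A ^ 2)] at this
  rw [show l + 1 = 2 + (l-1) by omega, show r + 1 = 2 + (r-1) by omega, hd, show 2 * (k-1) = 2 + (l-1)+(r-1) by omega]
  exact this

lemma col_sq (φ : Sym2 V → C)
    (hφ : ∀ ⦃a b c : V⦄, G.Adj a b → G.Adj a c → b ≠ c → φ s(a, b) ≠ φ s(a, c)) :
    ∑ c ∈ univ.image φ, colM G φ c * colM G φ c = diagonal (fun v => (G.degree v : ℝ)) := by
  ext u w
  rw [Matrix.sum_apply]
  simp only [Matrix.mul_apply, colM, Matrix.of_apply]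
  rw [Finset.sum_comm]
  have : ∀ y, ∑ c ∈ univ.image φ, ((if G.Adj u y ∧ φ s(u, y) = c then (1:ℝ) else 0) *
      (if G.Adj y w ∧ φ s(y, w) = c then 1 else 0)) = if G.Adj u y ∧ u = w then 1 else 0 := by
    intro y
    rw [Finset.sum_eq_single (φ s(u,y))]
    · by_cases h1 : G.Adj u y
      · by_cases h2 : u = w
        · subst h2; simp [h1, h1.symm, Sym2.eq_swap]
        · have : ¬ (G.Adj y w ∧ φ s(y, w) = φ s(u, y)) := by
            rintro ⟨h3, h4⟩
            refine hφ h1.symm h3 h2 ?_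
            rw [h4, Sym2.eq_swap]
          simp [this, h2]
      · simp [h1]
    · intro b _ hb; simp [hb.symm]
    · simp
  simp only [this, Matrix.diagonal_apply]
  by_cases h : u = w
  · simp [h, ← SimpleGraph.card_neighborFinset_eq_degree, SimpleGraph.neighborFinset_eq_filter]
  · simp [h]

lemma col_bound (φ : Sym2 V → C)
    (hφ : ∀ ⦃a b c : V⦄, G.Adj a b → G.Adj a c → b ≠ c → φ s(a, b) ≠ φ s(a, c)) 
    (k : ℕ) (hk : 2 ≤ k) (i j : ℕ) (hij : i < j) (hj : j < 2*k) :
    ∑ c ∈ univ.image φ, (mp (fun t => if t = i ∨ t = j then colM G φ c else G.adjMatrix ℝ) (2*k)).trace ≤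
     ∑ v, (G.degree v : ℝ) * (G.adjMatrix ℝ ^ (2*(k-1))) v v := by
  have e : ∑ v, (G.degree v : ℝ) * (G.adjMatrix ℝ ^ (2*(k-1))) v v = 
     ∑ c ∈ univ.image φ, (colM G φ c * colM G φ c * G.adjMatrix ℝ ^ (2*(k-1))).trace := by
    rw [← Matrix.trace_sum, ← Finset.sum_mul, col_sq G φ hφ, Matrix.trace]
    simp only [Matrix.diag, Matrix.diagonal_mul]
  rw [e]
  refine Finset.sum_le_sum fun c _ => ?_
  rw [mp_two_trace _ _ _ _ _ hij hj]
  have := trace_le (G.adjMatrix ℝ) (colM G φ c) (SimpleGraph.isSymm_adjMatrix G) (colM_symm G φ c) 0 (j-i-1) (2*k-1-(j-i))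
    ⟨k-1, by omega⟩ ⟨0, rfl⟩
  rw [pow_zero, mul_one, zero_add, zero_add] at this
  rw [show 2 * (k-1) = j-i-1+(2*k-1-(j-i)) by omega]
  exact this

lemma prod_two (A B : Matrix V V ℝ) (i j m : ℕ) (x : Fin (m+1) → V)
    (hA : ∀ t : Fin m, A (x t.castSucc) (x t.succ) = 1) (hi : i < m) (hj : j < m)
    (hBi : B (x (⟨i, hi⟩ : Fin m).castSucc) (x (⟨i, hi⟩ : Fin m).succ) = 1)
    (hBj : B (x (⟨j, hj⟩ : Fin m).castSucc) (x (⟨j, hj⟩ : Fin m).succ) = 1) :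
    ∏ t : Fin m, (fun t : ℕ => if t = i ∨ t = j then B else A) t (x t.castSucc) (x t.succ) = 1 := by
  refine Finset.prod_eq_one fun t _ => ?_
  by_cases h1 : (t : ℕ) = i
  · subst h1; simpa using hBi
  by_cases h2 : (t : ℕ) = j
  · subst h2; simpa using hBj
  simp only [h1, h2, or_self, if_false]; exact hA t

lemma union_bound (φ : Sym2 V → C) (m : ℕ) (hm : 0 < m)
    (hno : ¬ ∃ (u : V) (w : G.Walk u u), w.IsCycle ∧ w.length = m ∧ (w.edges.map φ).Nodup) :
    (G.adjMatrix ℝ ^ m).trace ≤ ∑ p ∈ (range m).offDiag.filter (fun p => p.1 < p.2), 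
      (∑ v, (mp (fun t => if t = p.1 ∨ t = p.2 then verM G v else G.adjMatrix ℝ) m).trace +
      ∑ c ∈ univ.image φ, (mp (fun t => if t = p.1 ∨ t = p.2 then colM G φ c else G.adjMatrix ℝ) m).trace) := by
  rw [← mp_const (fun _ => G.adjMatrix ℝ) _ m (fun _ _ => rfl)]
  simp only [mp_trace]
  have : ∀ p : ℕ × ℕ, ∀ F : V → (Fin (m+1) → V) → ℝ, ∀ F' : C → (Fin (m+1) → V) → ℝ, 
     ∑ v, ∑ x, F v x + ∑ c ∈ univ.image φ, ∑ x, F' c x = ∑ x, (∑ v, F v x + ∑ c ∈ univ.image φ, F' c x) := by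
    intro p F F'
    rw [Finset.sum_add_distrib, Finset.sum_comm, Finset.sum_comm (s := univ.image φ)]
  simp only [this (0,0)]
  rw [Finset.sum_comm]
  refine Finset.sum_le_sum fun x _ => ?_
  by_cases hx : x 0 = x (Fin.last m)
  swap
  · simp [hx]
  simp only [hx, if_true]
  have nnA : ∀ a b, 0 ≤ G.adjMatrix ℝ a b := fun a b => by
    rw [SimpleGraph.adjMatrix_apply]; split_ifs <;> norm_num
  have nnV : ∀ v a b, 0 ≤ verM G v a b := fun v a b => by
    rw [verM_apply]; split_ifs <;> norm_num
  have nnC : ∀ c a b, 0 ≤ colM G φ c a b := fun v a b => by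
    simp only [colM, Matrix.of_apply]; split_ifs <;> norm_num
  have nn1 : ∀ (p : ℕ × ℕ) (v : V), 0 ≤ ∏ t : Fin m, (if (t:ℕ) = p.1 ∨ (t:ℕ) = p.2 then verM G v else G.adjMatrix ℝ) (x t.castSucc) (x t.succ) := by
    intro p v; refine Finset.prod_nonneg fun t _ => ?_
    split_ifs
    · exact nnV _ _ _
    · exact nnA _ _
  have nn2 : ∀ (p : ℕ × ℕ) (c : C), 0 ≤ ∏ t : Fin m, (if (t:ℕ) = p.1 ∨ (t:ℕ) = p.2 then colM G φ c else G.adjMatrix ℝ) (x t.castSucc) (x t.succ) := by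
    intro p v; refine Finset.prod_nonneg fun t _ => ?_
    split_ifs
    · exact nnC _ _ _
    · exact nnA _ _
  have nn3 := fun p => Finset.sum_nonneg (s := univ) fun v _ => nn1 p v
  have nn4 := fun p => Finset.sum_nonneg (s := univ.image φ) fun v _ => nn2 p v
  by_cases hadj : ∀ t : Fin m, G.Adj (x t.castSucc) (x t.succ)
  swap
  · push Not at hadj
    obtain ⟨t, ht⟩ := hadj
    rw [Finset.prod_eq_zero (Finset.mem_univ t) (by simp [ht])]
    exact Finset.sum_nonneg fun p _ => add_nonneg (nn3 p) (nn4 p)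
  have hA1 : ∀ t : Fin m, G.adjMatrix ℝ (x t.castSucc) (x t.succ) = 1 := fun t => by simp [hadj t]
  rw [Finset.prod_eq_one (fun t _ => hA1 t)]
  let y : ℕ → V := fun n => if h : n < m + 1 then x ⟨n, h⟩ else x 0
  have y1 : ∀ t (h : t < m), y t = x (⟨t, h⟩ : Fin m).castSucc := fun t h => by
    simp only [y]; rw [dif_pos (by omega)]; rfl
  have y2 : ∀ t (h : t < m), y (t+1) = x (⟨t, h⟩ : Fin m).succ := fun t h => by
    simp only [y]; rw [dif_pos (by omega)]; rfl
  obtain ⟨i, j, hij, hj, hor⟩ := fail_of G φ m hm hno y 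
    (fun t ht => by rw [y1 t ht, y2 t ht]; exact hadj _) 
    (by simp only [y]; rw [dif_pos (by omega), dif_pos (by omega)]; exact hx)
  have hi : i < m := by omega
  rw [y2 i hi, y2 j hj, y1 i hi, y1 j hj] at hor
  refine le_trans ?_ (Finset.single_le_sum (fun p _ => add_nonneg (nn3 p) (nn4 p)) 
    (show (i,j) ∈ (range m).offDiag.filter (fun p => p.1 < p.2) by simp; omega))
  rcases hor with h | h
  · refine le_add_of_le_of_nonneg ?_ (nn4 _)
    refine le_trans ?_ (Finset.single_le_sum (fun v _ => nn1 (i,j) v) (Finset.mem_univ (x (⟨i, hi⟩ : Fin m).succ)))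
    refine (prod_two (G.adjMatrix ℝ) (verM G _) i j m x hA1 hi hj ?_ ?_).ge
    · rw [verM_apply, if_pos ⟨hadj _, rfl⟩]
    · rw [verM_apply, if_pos ⟨hadj _, h.symm⟩]
  · refine le_add_of_nonneg_of_le (nn3 _) ?_
    refine le_trans ?_ (Finset.single_le_sum (fun v _ => nn2 (i,j) v) (Finset.mem_image_of_mem φ (Finset.mem_univ s(x (⟨i, hi⟩ : Fin m).castSucc, x (⟨i, hi⟩ : Fin m).succ))))
    refine (prod_two (G.adjMatrix ℝ) (colM G φ _) i j m x hA1 hi hj ?_ ?_).ge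
    · rw [colM, Matrix.of_apply, if_pos ⟨hadj _, rfl⟩]
    · rw [colM, Matrix.of_apply, if_pos ⟨hadj _, h.symm⟩]

lemma card_pairs (m : ℕ) : 2 * ((range m).offDiag.filter (fun p => p.1 < p.2)).card ≤ m * m := by
  set P := (range m).offDiag.filter (fun p => p.1 < p.2)
  have h : P.card = ((range m).offDiag.filter (fun p => p.2 < p.1)).card := by
    refine Finset.card_bij (fun p _ => p.swap) ?_ ?_ ?_
    · rintro ⟨a, b⟩ h; simp [P] at h ⊢; omega
    · rintro ⟨a, b⟩ h ⟨c, d⟩ h' he; simpa [and_comm] using he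
    · rintro ⟨a, b⟩ h; refine ⟨(b, a), ?_, rfl⟩; simp [P] at h ⊢; omega
  have h2 : P.card + ((range m).offDiag.filter (fun p => p.2 < p.1)).card ≤ ((range m) ×ˢ (range m)).card := by
    rw [← Finset.card_union_of_disjoint]
    · refine Finset.card_le_card fun p hp => ?_
      simp [P] at hp ⊢; omega
    · rw [Finset.disjoint_filter]; intro p _ h; omega
  rw [Finset.card_product, Finset.card_range] at h2
  omega

lemma main_count (φ : Sym2 V → C)
    (hφ : ∀ ⦃a b c : V⦄, G.Adj a b → G.Adj a c → b ≠ c → φ s(a, b) ≠ φ s(a, c)) 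
    (k : ℕ) (hk : 2 ≤ k) 
    (hno : ¬ ∃ (u : V) (w : G.Walk u u), w.IsCycle ∧ w.length = 2 * k ∧ (w.edges.map φ).Nodup) :
    (G.adjMatrix ℝ ^ (2*k)).trace ≤ 4 * (k:ℝ)^2 * ∑ v, (G.degree v : ℝ) * (G.adjMatrix ℝ ^ (2*(k-1))) v v := by
  refine (union_bound G φ (2*k) (by omega) hno).trans ?_
  set T := ∑ v, (G.degree v : ℝ) * (G.adjMatrix ℝ ^ (2*(k-1))) v v with hT
  have hT0 : 0 ≤ T := Finset.sum_nonneg fun v _ => mul_nonneg (by positivity) (diag_nonneg G _ _)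
  refine (Finset.sum_le_card_nsmul _ _ (2 * T) ?_).trans ?_
  · rintro ⟨i, j⟩ h
    simp at h
    have := ver_bound G k hk i j (by omega) (by omega)
    have := col_bound G φ hφ k hk i j (by omega) (by omega)
    simp only at *
    linarith
  · have := card_pairs (2*k)
    have h2 : (2 * ((range (2*k)).offDiag.filter (fun p => p.1 < p.2)).card : ℝ) ≤ (2*k)*(2*k) := by exact_mod_cast this
    rw [nsmul_eq_mul]
    nlinarith

lemma final_ineq [Nonempty V] (φ : Sym2 V → C)
    (hφ : ∀ ⦃a b c : V⦄, G.Adj a b → G.Adj a c → b ≠ c → φ s(a, b) ≠ φ s(a, c)) 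
    (k : ℕ) (hk : 2 ≤ k) 
    (hno : ¬ ∃ (u : V) (w : G.Walk u u), w.IsCycle ∧ w.length = 2 * k ∧ (w.edges.map φ).Nodup) :
    (2 * (Nat.card G.edgeSet : ℝ) / Fintype.card V) ^ (2*k) ≤ (4 * (k:ℝ)^2)^k * ∑ v, (G.degree v : ℝ)^k := by
  have hc := main_count G φ hφ k hk hno
  obtain ⟨U, l, h1, h2, h⟩ := exists_spec (G.adjMatrix ℝ) (SimpleGraph.isSymm_adjMatrix G)
  have hn : (0:ℝ) < Fintype.card V := by exact_mod_cast Fintype.card_pos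
  have hA : ∑ u, ∑ v, G.adjMatrix ℝ u v = Fintype.card V * (2 * (Nat.card G.edgeSet : ℝ) / Fintype.card V) := by
    have e1 : ∀ u, ∑ v, G.adjMatrix ℝ u v = G.degree u := fun u => by
      simp [SimpleGraph.adjMatrix_apply, ← SimpleGraph.card_neighborFinset_eq_degree, SimpleGraph.neighborFinset_eq_filter]
    simp only [e1]
    have := G.sum_degrees_eq_twice_card_edges
    rw [mul_div_cancel₀ _ hn.ne', Nat.card_eq_fintype_card, ← SimpleGraph.edgeFinset_card]
    exact_mod_cast this
  refine (eig_lower _ U l h1 h _ (by positivity) hA k).trans ?_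
  have htr : (G.adjMatrix ℝ ^ (2*k)).trace = ∑ i, l i ^ (2*k) := by
    rw [h, Matrix.trace_mul_comm, ← mul_assoc, h2, one_mul, Matrix.trace_diagonal]
  have hb := T_bound _ U l h1 h2 h (fun v => (G.degree v : ℝ)) (fun v => by positivity) (4 * (k:ℝ)^2) (by positivity) (k-1)
  rw [htr] at hc
  obtain ⟨n, rfl⟩ : ∃ n, k = n + 1 := ⟨k-1, by omega⟩
  simp only [Nat.add_sub_cancel] at hb hc
  have := mul_le_mul_of_nonneg_left hc (show (0:ℝ) ≤ n + 1 by positivity)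
  linarith

lemma card_star (k : ℕ) : (Nat.card {pr : V × (Fin k → V) // ∀ i, G.Adj pr.1 (pr.2 i)} : ℝ) = ∑ v, (G.degree v : ℝ)^k := by
  let e : {pr : V × (Fin k → V) // ∀ i, G.Adj pr.1 (pr.2 i)} ≃ Σ v : V, (Fin k → G.neighborSet v) :=
    { toFun := fun p => ⟨p.1.1, fun i => ⟨p.1.2 i, p.2 i⟩⟩
      invFun := fun p => ⟨(p.1, fun i => (p.2 i).1), fun i => (p.2 i).2⟩
      left_inv := fun _ => rfl
      right_inv := fun _ => rfl }
  rw [Nat.card_congr e, Nat.card_eq_fintype_card, Fintype.card_sigma]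
  simp only [Fintype.card_fun, Fintype.card_fin, SimpleGraph.card_neighborSet_eq_degree]
  push_cast
  rfl
end


/-- Let `k ≥ 2` and let `G` be a properly edge-colored `n`-vertex graph
with edge density `p = 2e(G)/n²`. If `|Hom(S_k, G)| ≤ 10·n^{k+1}·p^k` and `G` contains no
rainbow cycle of length `2k`, then `e(G) ≤ 2·10^{1/k}·k²·n^{1+1/k}`. -/
theorem edge_bound_of_near_regular {V C : Type*} [Fintype V] (k : ℕ) (hk : 2 ≤ k)
    (G : SimpleGraph V) (φ : Sym2 V → C)
    (hφ : ∀ ⦃a b c : V⦄, G.Adj a b → G.Adj a c → b ≠ c → φ s(a, b) ≠ φ s(a, c))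
    (p : ℝ) (hp : p = 2 * (Nat.card G.edgeSet : ℝ) / (Fintype.card V : ℝ) ^ 2)
    (hSk : (Nat.card {pr : V × (Fin k → V) // ∀ i, G.Adj pr.1 (pr.2 i)} : ℝ) ≤
      10 * (Fintype.card V : ℝ) ^ (k + 1) * p ^ k)
    (hno : ¬ ∃ (u : V) (w : G.Walk u u), w.IsCycle ∧ w.length = 2 * k ∧
      (w.edges.map φ).Nodup) :
    (Nat.card G.edgeSet : ℝ) ≤
      2 * (10 : ℝ) ^ ((1 : ℝ) / k) * (k : ℝ) ^ 2 * (Fintype.card V : ℝ) ^ ((1 : ℝ) + 1 / k) := by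
  classical
  rcases isEmpty_or_nonempty V with hV | hV
  · have : Nat.card G.edgeSet = 0 := by
      have : IsEmpty G.edgeSet := ⟨fun e => by
        obtain ⟨e, he⟩ := e
        induction e with
        | h a b => exact hV.elim a⟩
      exact Nat.card_of_isEmpty
    rw [this]; push_cast; positivity
  have h1 := final_ineq G φ hφ k hk hno
  rw [← card_star] at h1
  have hn : (0:ℝ) < Fintype.card V := by exact_mod_cast Fintype.card_pos
  set n : ℝ := ((Fintype.card V : ℕ) : ℝ) with hndef
  set e : ℝ := (Nat.card G.edgeSet : ℝ) with he
  have he0 : 0 ≤ e := by positivity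
  set D := 2 * e / n with hD
  have hD0 : 0 ≤ D := by positivity
  have h2 : 10 * n ^ (k+1) * p ^ k = 10 * n * D ^ k := by
    have : p = D / n := by rw [hp, hD]; field_simp
    rw [this, div_pow]; field_simp; ring
  rw [h2] at hSk
  have h3 : D ^ k * D ^ k ≤ ((4 * (k:ℝ)^2)^k * (10 * n)) * D ^ k := by
    have := mul_le_mul_of_nonneg_left hSk (show 0 ≤ (4 * (k:ℝ)^2)^k by positivity)
    rw [two_mul k, pow_add] at h1
    linarith
  have hk0 : k ≠ 0 := by omega
  have hkr : (k:ℝ) ≠ 0 := by exact_mod_cast hk0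
  have h4 : D ≤ 4 * (k:ℝ)^2 * (10 * n) ^ ((1:ℝ)/k) := by
    rcases hD0.eq_or_lt with h0 | hpos
    · rw [← h0]; positivity
    · refine le_of_pow_le_pow_left₀ hk0 (by positivity) ?_
      rw [mul_pow, ← Real.rpow_natCast ((10 * n) ^ ((1:ℝ)/k)), ← Real.rpow_mul (by positivity), one_div, inv_mul_cancel₀ hkr, Real.rpow_one]
      exact le_of_mul_le_mul_right h3 (by positivity)
  have h5 : e = n * D / 2 := by rw [hD]; field_simp
  rw [Real.mul_rpow (by norm_num) hn.le] at h4
  rw [Real.rpow_add hn, Real.rpow_one, h5]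
  have := mul_le_mul_of_nonneg_left h4 hn.le
  linarith
end
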